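/- arXiv:2003.06456 — 6 statements merged into one kernel-verified Lean document; each statement's English description precedes it below -/
import Mathlib

section
/- Let (X,d) be a metric space and let Γ ⊆ X be such that for every R > 0 there exists n_R ∈ ℕ with #(Γ ∩ B(x,R)) ≤ n_R for all x ∈ X. Suppose Γ = ⋃_{i∈ℕ} Γ_i where the sets Γ_i are nonempty, finite, pairwise disjoint, satisfy #Γ_i ≤ #Γ_{i+1} for all i, and #Γ_i → ∞ as i → ∞. Then for every R > 0 and every j ∈ ℕ there exists ī(R,j) ∈ ℕ such that for all i ≥ ī(R,j) and every x ∈ Γ_i there is a subset Γ_i(x) ⊆ Γ_i with: (i) x ∈ Γ_i(x); (ii) d(y,z) > R whenever y,z ∈ Γ_i(x) are distinct; (iii) #Γ_i(x) ≥ j. -/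
open Metric Filter

/-- If every closed ball of radius `R` contains at most `n` points of a finite set `A` with more
than `k * n` elements, then every point of `A` lies in an `R`-separated subset of `A` with
`k + 1` elements. -/
theorem exists_separated_finset {X : Type*} [MetricSpace X] (A : Finset X) {R : ℝ} (hR : 0 ≤ R)
    (n : ℕ) (hA : ∀ x : X, ((A : Set X) ∩ closedBall x R).ncard ≤ n) {x : X}
    (hx : x ∈ A) (k : ℕ) (hk : k * n < A.card) :
    ∃ S ⊆ A, x ∈ S ∧ (∀ y ∈ S, ∀ z ∈ S, y ≠ z → R < dist y z) ∧ S.card = k + 1 := by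
  classical
  induction k with
  | zero =>
    refine ⟨{x}, by simpa using hx, by simp, ?_, by simp⟩
    intro y hy z hz hyz
    simp only [Finset.mem_singleton] at hy hz
    exact absurd (hy.trans hz.symm) hyz
  | succ k ih =>
    obtain ⟨S, hSA, hxS, hsep, hcard⟩ := ih (lt_of_le_of_lt (by gcongr; omega) hk)
    have hball : ∀ y ∈ S, (A.filter (fun z => dist z y ≤ R)).card ≤ n := by
      intro y _
      rw [← Set.ncard_coe_finset, Finset.coe_filter]
      exact hA y
    have hU := Finset.card_biUnion_le_card_mul S _ n hball
    rw [hcard] at hU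
    obtain ⟨z, hzA, hzU⟩ := Finset.exists_mem_notMem_of_card_lt_card (hU.trans_lt hk)
    have hfar : ∀ y ∈ S, R < dist z y := by
      intro y hy
      by_contra! h
      exact hzU (Finset.mem_biUnion.2 ⟨y, hy, Finset.mem_filter.2 ⟨hzA, h⟩⟩)
    have hzS : z ∉ S := fun hz => hR.not_gt (by simpa using hfar z hz)
    refine ⟨insert z S, Finset.insert_subset hzA hSA, Finset.mem_insert_of_mem hxS, ?_, ?_⟩
    · intro a ha b hb hab
      rcases Finset.mem_insert.1 ha with rfl | haS <;> rcases Finset.mem_insert.1 hb with rfl | hbS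
      · exact absurd rfl hab
      · exact hfar b hbS
      · rw [dist_comm]
        exact hfar a haS
      · exact hsep a haS b hbS hab
    · rw [Finset.card_insert_of_notMem hzS, hcard]

/-- (Lemma on separated subsets of quasiorbits.) If `Γ = ⋃ᵢ Γᵢ` is an orbital
discretization (nonempty, finite, pairwise disjoint quasiorbits with nondecreasing cardinalities
tending to infinity) and `Γ` meets every ball of radius `R` in at most `n_R` points, then for
every `R > 0` and `j` there is `ī(R,j)` such that for all `i ≥ ī(R,j)` and every `x ∈ Γᵢ` there
is a subset `Γᵢ(x) ⊆ Γᵢ` containing `x`, `R`-separated, with at least `j` elements. -/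
theorem stmt2 {X : Type*} [MetricSpace X] (Γ : Set X) (Γi : ℕ → Set X)
    (hcount : ∀ R : ℝ, 0 < R → ∃ nR : ℕ, ∀ x : X,
      (Γ ∩ ball x R).Finite ∧ (Γ ∩ ball x R).ncard ≤ nR)
    (hunion : Γ = ⋃ i, Γi i)
    (hne : ∀ i, (Γi i).Nonempty)
    (hfin : ∀ i, (Γi i).Finite)
    (hdisj : ∀ i j, i ≠ j → Disjoint (Γi i) (Γi j))
    (hmono : ∀ i, (Γi i).ncard ≤ (Γi (i + 1)).ncard)
    (htend : Tendsto (fun i => (Γi i).ncard) atTop atTop) :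
    ∀ R : ℝ, 0 < R → ∀ j : ℕ, ∃ ibar : ℕ, ∀ i, ibar ≤ i → ∀ x ∈ Γi i,
      ∃ S ⊆ Γi i, x ∈ S ∧ (∀ y ∈ S, ∀ z ∈ S, y ≠ z → R < dist y z) ∧ j ≤ S.ncard := by
  intro R hR j
  obtain ⟨n, hn⟩ := hcount (R + 1) (by linarith)
  obtain ⟨N, hN⟩ := eventually_atTop.1 (htend.eventually_gt_atTop (j * n))
  refine ⟨N, fun i hi x hx => ?_⟩
  have hcoe : ((hfin i).toFinset : Set X) = Γi i := (hfin i).coe_toFinset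
  have hball : ∀ y : X, (((hfin i).toFinset : Set X) ∩ closedBall y R).ncard ≤ n := by
    intro y
    refine (Set.ncard_le_ncard ?_ (hn y).1).trans (hn y).2
    rw [hcoe, hunion]
    exact Set.inter_subset_inter (Set.subset_iUnion Γi i) (closedBall_subset_ball (by linarith))
  obtain ⟨S, hSA, hxS, hsep, hcard⟩ := exists_separated_finset (hfin i).toFinset hR.le n hball
    ((hfin i).mem_toFinset.2 hx) j (by
      rw [← Set.ncard_eq_toFinset_card (Γi i) (hfin i)]
      exact hN i hi)
  refine ⟨S, fun y hy => (hfin i).mem_toFinset.1 (hSA hy), hxS, hsep, ?_⟩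
  rw [Set.ncard_coe_finset, hcard]
  exact Nat.le_succ j
end

section
/- ('Spotlight lemma', Euclidean case.) Let m ≥ 2, 1 < p < m, and q ∈ (p, p*). Let ε > 0, let ν ≥ 1 be an integer, and let Γ ⊆ ℝ^m be an (ε,ν)-discretization of ℝ^m. Let (u_k) be a sequence of compactly supported Lipschitz functions ℝ^m → ℝ with sup_k E_p(u_k) < ∞. Then ∫_{ℝ^m}|u_k|^q dx → 0 if and only if ∫_{B(y_k,νε)}|u_k| dx → 0 for every sequence (y_k) with y_k ∈ Γ. -/
open MeasureTheory Metric Filter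
open scoped NNReal ENNReal

/-- The `p`-th power of the `H^{1,p}` norm of a (Lipschitz) function on `ℝ^m`. -/
noncomputable def Ep (m : ℕ) (p : ℝ) (u : EuclideanSpace ℝ (Fin m) → ℝ) : ℝ :=
  ∫ x, (‖fderiv ℝ u x‖ ^ p + |u x| ^ p)

/-- `Γ` is an `(ε,ν)`-discretization of `ℝ^m`: `ε`-separated and the balls `B(y,νε)`, `y ∈ Γ`,
cover `ℝ^m`. -/
def IsDiscretization (m : ℕ) (ε : ℝ) (ν : ℕ) (Γ : Set (EuclideanSpace ℝ (Fin m))) : Prop :=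
  (∀ y ∈ Γ, ∀ y' ∈ Γ, y ≠ y' → ε ≤ dist y y') ∧
  (∀ x : EuclideanSpace ℝ (Fin m), ∃ y ∈ Γ, x ∈ ball y (ν * ε))

section Averaging

/-- The average of the translates of `u` with respect to the measure `ρ`. -/
noncomputable def translateAverage {E : Type*} [Sub E] [MeasurableSpace E] (ρ : Measure E)
    (u : E → ℝ) (x : E) : ℝ :=
  ∫ y, u (x - y) ∂ρ

theorem enorm_translateAverage_le {E : Type*} [Sub E] [MeasurableSpace E] (ρ : Measure E)
    (u : E → ℝ) (x : E) :
    ‖translateAverage ρ u x‖ₑ ≤ ∫⁻ y, ‖u (x - y)‖ₑ ∂ρ :=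
  enorm_integral_le_lintegral_enorm _

variable {E : Type*} [NormedAddCommGroup E] [NormedSpace ℝ E] [FiniteDimensional ℝ E]
  [MeasurableSpace E] [BorelSpace E]

/-- Jensen's inequality for powers of nonnegative functions on a probability space. -/
theorem rpow_lintegral_le_lintegral_rpow {α : Type*} [MeasurableSpace α] (μ : Measure α)
    [IsProbabilityMeasure μ] {p : ℝ} (hp : 1 ≤ p) {f : α → ℝ≥0∞} (hf : Measurable f) :
    (∫⁻ a, f a ∂μ) ^ p ≤ ∫⁻ a, f a ^ p ∂μ := by
  have hp0 : 0 < p := by linarith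
  have h := eLpNorm'_le_eLpNorm'_of_exponent_le one_pos hp μ hf.aestronglyMeasurable
  simp only [eLpNorm', enorm_eq_self, ENNReal.rpow_one, div_one] at h
  rwa [one_div, ENNReal.le_rpow_inv_iff hp0] at h

/-- Minkowski's inequality: averaging translates does not increase the `L^p` norm. -/
theorem lintegral_rpow_lintegral_sub_le (μ : Measure E) [μ.IsAddHaarMeasure] {α : Type*}
    [MeasurableSpace α] (ρ : Measure α) [IsProbabilityMeasure ρ] {p : ℝ} (hp : 1 ≤ p)
    {f : E → ℝ≥0∞} (hf : Measurable f) {T : α → E} (hT : Measurable T) :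
    ∫⁻ x, (∫⁻ a, f (x - T a) ∂ρ) ^ p ∂μ ≤ ∫⁻ x, f x ^ p ∂μ := by
  calc ∫⁻ x, (∫⁻ a, f (x - T a) ∂ρ) ^ p ∂μ
      ≤ ∫⁻ x, ∫⁻ a, f (x - T a) ^ p ∂ρ ∂μ := by
        gcongr with x
        exact rpow_lintegral_le_lintegral_rpow ρ hp (by fun_prop)
    _ = ∫⁻ a, ∫⁻ x, f (x - T a) ^ p ∂μ ∂ρ :=
        lintegral_lintegral_swap (by simp only [Function.uncurry_def]; fun_prop)
    _ = ∫⁻ _, ∫⁻ x, f x ^ p ∂μ ∂ρ := by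
        congr with a
        exact lintegral_sub_right_eq_self (fun x => f x ^ p) (T a)
    _ = ∫⁻ x, f x ^ p ∂μ := by simp

theorem lintegral_translateAverage_rpow_le (μ : Measure E) [μ.IsAddHaarMeasure] (ρ : Measure E)
    [IsProbabilityMeasure ρ] {p : ℝ} (hp : 1 ≤ p) {u : E → ℝ} (hu : Measurable u) :
    ∫⁻ x, ‖translateAverage ρ u x‖ₑ ^ p ∂μ ≤ ∫⁻ x, ‖u x‖ₑ ^ p ∂μ :=
  (lintegral_mono fun x =>
    ENNReal.rpow_le_rpow (enorm_translateAverage_le ρ u x) (by linarith)).trans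
    (lintegral_rpow_lintegral_sub_le μ ρ hp hu.enorm measurable_id)

theorem integrable_comp_sub {ρ : Measure E} [IsFiniteMeasure ρ] {u : E → ℝ}
    (hu : Continuous u) (hsupp : HasCompactSupport u) (x : E) :
    Integrable (fun y => u (x - y)) ρ := by
  obtain ⟨C, hC⟩ := hsupp.exists_bound_of_continuous hu
  exact Integrable.of_bound (by fun_prop) C (.of_forall fun y => hC _)

theorem setLIntegral_translateAverage_le {μ : Measure E} [μ.IsAddHaarMeasure] {ρ : Measure E}
    [IsProbabilityMeasure ρ] {u : E → ℝ} (hu : Measurable u) {r : ℝ} {σ : ℝ≥0∞}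
    (h : ∀ x, ∫⁻ z in ball x r, ‖u z‖ₑ ∂μ ≤ σ) (x : E) :
    ∫⁻ z in ball x r, ‖translateAverage ρ u z‖ₑ ∂μ ≤ σ := by
  calc ∫⁻ z in ball x r, ‖translateAverage ρ u z‖ₑ ∂μ
      ≤ ∫⁻ z in ball x r, ∫⁻ y, ‖u (z - y)‖ₑ ∂ρ ∂μ :=
        lintegral_mono fun z => enorm_translateAverage_le ρ u z
    _ = ∫⁻ y, ∫⁻ z in ball x r, ‖u (z - y)‖ₑ ∂μ ∂ρ :=
        lintegral_lintegral_swap (by simp only [Function.uncurry_def]; fun_prop)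
    _ ≤ ∫⁻ _, σ ∂ρ := by
        gcongr with y
        refine le_trans (le_of_eq ?_) (h (x - y))
        rw [← lintegral_indicator measurableSet_ball, ← lintegral_indicator measurableSet_ball,
          ← lintegral_sub_right_eq_self ((ball (x - y) r).indicator _) y]
        congr with z
        simp [Set.indicator, mem_ball, dist_eq_norm]
    _ = σ := by simp

theorem translateAverage_sub_le {ρ : Measure E} [IsProbabilityMeasure ρ] {δ : ℝ}
    (hρ : ∀ᵐ y ∂ρ, ‖y‖ ≤ δ) {u : E → ℝ} {L : ℝ≥0} (hu : LipschitzWith L u)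
    (hsupp : HasCompactSupport u) (x : E) :
    ‖translateAverage ρ u x - u x‖ ≤ L * δ := by
  have h : translateAverage ρ u x - u x = ∫ y, (u (x - y) - u x) ∂ρ := by
    rw [integral_sub (integrable_comp_sub hu.continuous hsupp x) (integrable_const _)]
    simp [translateAverage]
  rw [h]
  refine (norm_integral_le_of_norm_le_const (C := L * δ) ?_).trans (by simp)
  filter_upwards [hρ] with y hy
  refine (hu.norm_sub_le _ _).trans ?_
  gcongr
  simpa using hy

/-- The `L^p` distance between a `C^1` function and the average of its translates by vectors of
length at most `δ` is at most `δ` times the `L^p` norm of the derivative. -/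
theorem lintegral_sub_translateAverage_rpow_le (μ : Measure E) [μ.IsAddHaarMeasure] {ρ : Measure E}
    [IsProbabilityMeasure ρ] {δ : ℝ} (hρ : ∀ᵐ y ∂ρ, ‖y‖ ≤ δ) {p : ℝ} (hp : 1 ≤ p)
    {v : E → ℝ} (hv : ContDiff ℝ 1 v) (hsupp : HasCompactSupport v) :
    ∫⁻ x, ‖v x - translateAverage ρ v x‖ₑ ^ p ∂μ ≤
      ENNReal.ofReal δ ^ p * ∫⁻ x, ‖fderiv ℝ v x‖ₑ ^ p ∂μ := by
  have hp0 : 0 ≤ p := by linarith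
  have hdv : Continuous (fderiv ℝ v) := hv.continuous_fderiv one_ne_zero
  let I : Measure ℝ := volume.restrict (Set.Ioc 0 1)
  have : IsProbabilityMeasure I := ⟨by simp [I]⟩
  have key (x y : E) : ‖v x - v (x - y)‖ₑ ≤ ‖y‖ₑ * ∫⁻ t, ‖fderiv ℝ v (x - t • y)‖ₑ ∂I := by
    have hd (t : ℝ) : HasDerivAt (fun t : ℝ => v (x - t • y)) (fderiv ℝ v (x - t • y) (-y)) t := by
      have h1 : HasDerivAt (fun t : ℝ => x - t • y) (-y) t := by
        simpa using ((hasDerivAt_id t).smul_const y).const_sub x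
      exact ((hv.differentiable one_ne_zero) _).hasFDerivAt.comp_hasDerivAt t h1
    have h2 := intervalIntegral.integral_eq_sub_of_hasDerivAt (a := 0) (b := 1)
      (fun t _ => hd t) (Continuous.intervalIntegrable (by fun_prop) _ _)
    rw [enorm_sub_rev]
    simp only [one_smul, zero_smul, sub_zero] at h2
    rw [← h2, intervalIntegral.integral_of_le zero_le_one]
    refine (enorm_integral_le_lintegral_enorm _).trans ?_
    rw [← lintegral_const_mul _ (by fun_prop)]
    refine lintegral_mono fun t => ?_
    rw [mul_comm]
    simpa using (fderiv ℝ v (x - t • y)).le_opENorm (-y)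
  have key2 (x : E) : ‖v x - translateAverage ρ v x‖ₑ ≤
      ENNReal.ofReal δ * ∫⁻ a, ‖fderiv ℝ v (x - a.2 • a.1)‖ₑ ∂(ρ.prod I) := by
    have h : v x - translateAverage ρ v x = ∫ y, (v x - v (x - y)) ∂ρ := by
      rw [integral_sub (integrable_const _) (integrable_comp_sub hv.continuous hsupp x)]
      simp [translateAverage]
    rw [h, lintegral_prod _ (by fun_prop), ← lintegral_const_mul _ (by fun_prop)]
    refine (enorm_integral_le_lintegral_enorm _).trans (lintegral_mono_ae ?_)
    filter_upwards [hρ] with y hy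
    refine (key x y).trans ?_
    gcongr
    rw [← ofReal_norm]
    exact ENNReal.ofReal_le_ofReal hy
  calc ∫⁻ x, ‖v x - translateAverage ρ v x‖ₑ ^ p ∂μ
      ≤ ∫⁻ x, ENNReal.ofReal δ ^ p *
          (∫⁻ a, ‖fderiv ℝ v (x - a.2 • a.1)‖ₑ ∂(ρ.prod I)) ^ p ∂μ := by
        gcongr with x
        rw [← ENNReal.mul_rpow_of_nonneg _ _ hp0]
        exact ENNReal.rpow_le_rpow (key2 x) hp0
    _ = ENNReal.ofReal δ ^ p *
          ∫⁻ x, (∫⁻ a, ‖fderiv ℝ v (x - a.2 • a.1)‖ₑ ∂(ρ.prod I)) ^ p ∂μ := by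
        refine lintegral_const_mul' _ _ (by finiteness)
    _ ≤ _ := by
        refine mul_le_mul_right ?_ _
        exact lintegral_rpow_lintegral_sub_le μ (ρ.prod I) hp (f := fun z => ‖fderiv ℝ v z‖ₑ)
          (by fun_prop) (T := fun a => a.2 • a.1) (by fun_prop)

/-- Averaging does not increase the `L^p` norm of the derivative. -/
theorem lintegral_fderiv_translateAverage_rpow_le (μ : Measure E) [μ.IsAddHaarMeasure]
    {ρ : Measure E} [IsProbabilityMeasure ρ] (hρ : ρ ≪ μ) {p : ℝ} (hp : 1 ≤ p)
    {u : E → ℝ} {L : ℝ≥0} (hu : LipschitzWith L u) (hsupp : HasCompactSupport u) :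
    ∫⁻ x, ‖fderiv ℝ (translateAverage ρ u) x‖ₑ ^ p ∂μ ≤ ∫⁻ x, ‖fderiv ℝ u x‖ₑ ^ p ∂μ := by
  have hm := measurable_fderiv ℝ u
  have key (x : E) : fderiv ℝ (translateAverage ρ u) x = ∫ y, fderiv ℝ u (x - y) ∂ρ := by
    have hd : ∀ᵐ y ∂ρ, DifferentiableAt ℝ u (x - y) :=
      hρ.ae_le ((quasiMeasurePreserving_sub_left_of_right_invariant μ x).ae hu.ae_differentiableAt)
    refine (hasFDerivAt_integral_of_dominated_loc_of_lip (𝕜 := ℝ) (s := Set.univ)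
      (F := fun z y => u (z - y)) (bound := fun _ => (L : ℝ)) univ_mem
      (.of_forall fun z => ?_) (integrable_comp_sub hu.continuous hsupp x)
      ?_ (.of_forall fun y => ?_) (integrable_const _) ?_).2.fderiv
    · exact (hu.continuous.comp (continuous_const.sub continuous_id)).aestronglyMeasurable
    · exact (hm.comp (measurable_const.sub measurable_id)).aestronglyMeasurable
    · rw [Real.nnabs_coe]
      refine LipschitzWith.lipschitzOnWith fun z w => ?_
      simpa using hu (z - y) (w - y)
    · filter_upwards [hd] with y hy
      exact (hasFDerivAt_comp_sub y).2 hy.hasFDerivAt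
  refine (lintegral_mono fun x => ?_).trans
    (lintegral_rpow_lintegral_sub_le μ ρ hp hm.enorm measurable_id)
  rw [key]
  exact ENNReal.rpow_le_rpow (enorm_integral_le_lintegral_enorm _) (by linarith)

/-- The probability measure whose density is a normalized bump function. -/
noncomputable def bumpMeasure (μ : Measure E) (φ : ContDiffBump (0 : E)) : Measure E :=
  μ.withDensity fun y => ENNReal.ofReal (φ.normed μ y)

instance isProbabilityMeasure_bumpMeasure (μ : Measure E) [μ.IsAddHaarMeasure]
    (φ : ContDiffBump (0 : E)) : IsProbabilityMeasure (bumpMeasure μ φ) := by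
  refine ⟨?_⟩
  rw [bumpMeasure, withDensity_apply _ .univ, setLIntegral_univ,
    ← ofReal_integral_eq_lintegral_ofReal φ.integrable_normed (.of_forall φ.nonneg_normed),
    φ.integral_normed, ENNReal.ofReal_one]

theorem ae_bumpMeasure_norm_le (μ : Measure E) [μ.IsAddHaarMeasure] (φ : ContDiffBump (0 : E)) :
    ∀ᵐ y ∂bumpMeasure μ φ, ‖y‖ ≤ φ.rOut := by
  rw [bumpMeasure, ae_withDensity_iff φ.continuous_normed.measurable.ennreal_ofReal]
  refine .of_forall fun y hy => ?_
  have : y ∈ Function.support (φ.normed μ) := fun h => hy (by simp [h])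
  rw [φ.support_normed_eq, mem_ball_zero_iff] at this
  exact this.le

theorem translateAverage_bumpMeasure_eq_convolution (μ : Measure E) [μ.IsAddHaarMeasure]
    (φ : ContDiffBump (0 : E)) (u : E → ℝ) :
    translateAverage (bumpMeasure μ φ) u =
      convolution (φ.normed μ) u (ContinuousLinearMap.lsmul ℝ ℝ) μ := by
  ext x
  rw [translateAverage, bumpMeasure, integral_withDensity_eq_integral_toReal_smul
    φ.continuous_normed.measurable.ennreal_ofReal (by simp), convolution_lsmul]
  simp only [ENNReal.toReal_ofReal (φ.nonneg_normed _)]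

theorem contDiff_translateAverage_bumpMeasure (μ : Measure E) [μ.IsAddHaarMeasure]
    (φ : ContDiffBump (0 : E)) {u : E → ℝ} (hu : Continuous u) :
    ContDiff ℝ 1 (translateAverage (bumpMeasure μ φ) u) := by
  rw [translateAverage_bumpMeasure_eq_convolution]
  exact φ.hasCompactSupport_normed.contDiff_convolution_left _ (φ.contDiff_normed (n := 1))
    hu.locallyIntegrable

theorem hasCompactSupport_translateAverage_bumpMeasure (μ : Measure E) [μ.IsAddHaarMeasure]
    (φ : ContDiffBump (0 : E)) {u : E → ℝ} (hu : HasCompactSupport u) :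
    HasCompactSupport (translateAverage (bumpMeasure μ φ) u) := by
  rw [translateAverage_bumpMeasure_eq_convolution]
  exact φ.hasCompactSupport_normed.convolution _ hu

/-- Mollification turns a uniform bound on the `L^1` norms over balls into a uniform bound. -/
theorem exists_enorm_translateAverage_bumpMeasure_le (μ : Measure E) [μ.IsAddHaarMeasure]
    (φ : ContDiffBump (0 : E)) :
    ∃ K : ℝ≥0∞, K ≠ ∞ ∧ ∀ (v : E → ℝ), Measurable v → ∀ x,
      ‖translateAverage (bumpMeasure μ φ) v x‖ₑ ≤ K * ∫⁻ z in ball x φ.rOut, ‖v z‖ₑ ∂μ := by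
  obtain ⟨K, hK⟩ := (φ.hasCompactSupport_normed (μ := μ)).exists_bound_of_continuous
    φ.continuous_normed
  refine ⟨ENNReal.ofReal K, by simp, fun v hv x => ?_⟩
  calc ‖translateAverage (bumpMeasure μ φ) v x‖ₑ
      ≤ ∫⁻ y, ‖v (x - y)‖ₑ ∂bumpMeasure μ φ := enorm_translateAverage_le _ _ _
    _ = ∫⁻ y, ENNReal.ofReal (φ.normed μ y) * ‖v (x - y)‖ₑ ∂μ := by
        rw [bumpMeasure, lintegral_withDensity_eq_lintegral_mul _
          φ.continuous_normed.measurable.ennreal_ofReal (by fun_prop)]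
        rfl
    _ = ∫⁻ z, ENNReal.ofReal (φ.normed μ (x - z)) * ‖v z‖ₑ ∂μ := by
        rw [← lintegral_sub_left_eq_self _ x]
        simp
    _ ≤ ∫⁻ z, ENNReal.ofReal K * (ball x φ.rOut).indicator (fun z => ‖v z‖ₑ) z ∂μ := by
        refine lintegral_mono fun z => ?_
        by_cases hz : z ∈ ball x φ.rOut
        · simp only [Set.indicator_of_mem hz]
          gcongr
          exact (le_abs_self _).trans (hK _)
        · have : x - z ∉ Function.support (φ.normed μ) := by
            rwa [φ.support_normed_eq, mem_ball_zero_iff, ← dist_eq_norm, dist_comm, ← mem_ball]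
          simp [Function.notMem_support.1 this]
    _ = ENNReal.ofReal K * ∫⁻ z in ball x φ.rOut, ‖v z‖ₑ ∂μ := by
        rw [lintegral_const_mul' _ _ (by simp), lintegral_indicator measurableSet_ball]

/-- The **Gagliardo-Nirenberg-Sobolev inequality** in terms of lower Lebesgue integrals. -/
theorem exists_lintegral_rpow_le_lintegral_fderiv (μ : Measure E) [μ.IsAddHaarMeasure] {p s : ℝ}
    (hp : 1 ≤ p) (hs : 0 < s) (hn : 0 < Module.finrank ℝ E)
    (hps : s⁻¹ = p⁻¹ - (Module.finrank ℝ E : ℝ)⁻¹) :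
    ∃ K : ℝ≥0∞, K ≠ ∞ ∧ ∀ v : E → ℝ, ContDiff ℝ 1 v → HasCompactSupport v →
      ∫⁻ x, ‖v x‖ₑ ^ s ∂μ ≤ K * (∫⁻ x, ‖fderiv ℝ v x‖ₑ ^ p ∂μ) ^ (s / p) := by
  have hp0 : 0 < p := by linarith
  lift p to ℝ≥0 using hp0.le
  lift s to ℝ≥0 using hs.le
  have hp' : p ≠ 0 := by simpa using hp0.ne'
  have hs' : s ≠ 0 := by simpa using hs.ne'
  refine ⟨(SNormLESNormFDerivOfEqConst ℝ μ p : ℝ≥0∞) ^ (s : ℝ), by finiteness, fun v hv hc => ?_⟩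
  have h := eLpNorm_le_eLpNorm_fderiv_of_eq μ hv hc (p := p) (p' := s) (mod_cast hp) hn hps
  rw [← eLpNorm_nnreal_pow_eq_lintegral hp', ← eLpNorm_nnreal_pow_eq_lintegral hs',
    ← ENNReal.rpow_mul, mul_div_cancel₀ _ hp0.ne', ← ENNReal.mul_rpow_of_nonneg _ _ hs.le]
  exact ENNReal.rpow_le_rpow h hs.le

theorem lintegral_rpow_le_interpolation {α : Type*} [MeasurableSpace α] (μ : Measure α)
    {p q s : ℝ} (hp : 0 < p) (hpq : p < q) (hqs : q < s) {f : α → ℝ≥0∞} (hf : Measurable f) :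
    ∫⁻ x, f x ^ q ∂μ ≤
      (∫⁻ x, f x ^ p ∂μ) ^ ((s - q) / (s - p)) * (∫⁻ x, f x ^ s ∂μ) ^ ((q - p) / (s - p)) := by
  have hsp : 0 < s - p := by linarith
  have ha : 0 ≤ (s - q) / (s - p) := div_nonneg (by linarith) hsp.le
  have hb : 0 ≤ (q - p) / (s - p) := div_nonneg (by linarith) hsp.le
  refine le_trans (le_of_eq ?_) (ENNReal.lintegral_mul_norm_pow_le (hf.pow_const p).aemeasurable
    (hf.pow_const s).aemeasurable ha hb (by field_simp; ring))
  congr with x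
  rw [← ENNReal.rpow_mul, ← ENNReal.rpow_mul,
    ← ENNReal.rpow_add_of_nonneg _ _ (by positivity) (mul_nonneg (by linarith) hb)]
  congr 1
  field_simp
  ring

/-- Quantitative vanishing lemma for `C^1` functions. -/
theorem exists_lintegral_rpow_le_of_contDiff (μ : Measure E) [μ.IsAddHaarMeasure] {p q s : ℝ}
    (hp : 1 ≤ p) (hpq : p < q) (hqs : q < s) (hn : 0 < Module.finrank ℝ E)
    (hps : s⁻¹ = p⁻¹ - (Module.finrank ℝ E : ℝ)⁻¹) {C : ℝ≥0∞} (hC : C ≠ ∞) {r : ℝ} (hr : 0 < r)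
    {η : ℝ≥0∞} (hη : η ≠ 0) :
    ∃ σ : ℝ≥0∞, 0 < σ ∧ ∀ v : E → ℝ, ContDiff ℝ 1 v → HasCompactSupport v →
      ∫⁻ x, ‖v x‖ₑ ^ p ∂μ ≤ C → ∫⁻ x, ‖fderiv ℝ v x‖ₑ ^ p ∂μ ≤ C →
      (∀ x, ∫⁻ z in ball x r, ‖v z‖ₑ ∂μ ≤ σ) → ∫⁻ x, ‖v x‖ₑ ^ q ∂μ ≤ η := by
  have hp0 : 0 < p := by linarith
  have hs1 : 1 ≤ s := by linarith
  have hsp : 0 < s - p := by linarith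
  obtain ⟨S, hS, hSob⟩ := exists_lintegral_rpow_le_lintegral_fderiv μ hp (by linarith) hn hps
  set a := (s - q) / (s - p)
  set b := (q - p) / (s - p)
  have ha : 0 < a := div_pos (by linarith) hsp
  have hb : 0 < b := div_pos (by linarith) hsp
  set X : ℝ≥0∞ := (2 ^ (s - 1) * (2 * (S * C ^ (s / p)))) ^ b
  have hXtop : X ≠ ∞ := by
    have : 0 ≤ s / p := by positivity
    have : 0 ≤ s - 1 := by linarith
    finiteness
  have h2q : (2 : ℝ≥0∞) ^ (q - 1) ≠ ∞ :=
    ENNReal.rpow_ne_top_of_nonneg (by linarith) (by simp)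
  obtain ⟨δ, hδ, hδr, hδη⟩ : ∃ δ : ℝ, 0 < δ ∧ δ ≤ r ∧
      2 ^ (q - 1) * ((ENNReal.ofReal δ ^ p * C) ^ a * X) ≤ η / 2 := by
    have hlim : Tendsto (fun δ : ℝ => 2 ^ (q - 1) * ((ENNReal.ofReal δ ^ p * C) ^ a * X))
        (nhdsWithin 0 (Set.Ioi 0)) (nhds 0) := by
      have h1 : Tendsto (fun δ : ℝ => ENNReal.ofReal δ ^ p * C)
          (nhdsWithin 0 (Set.Ioi 0)) (nhds 0) := by
        have h0 : Tendsto (fun δ : ℝ => ENNReal.ofReal δ) (nhdsWithin 0 (Set.Ioi 0)) (nhds 0) := by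
          have := ENNReal.continuous_ofReal.tendsto 0
          rw [ENNReal.ofReal_zero] at this
          exact this.mono_left nhdsWithin_le_nhds
        have := ENNReal.Tendsto.mul_const (b := C) (h0.ennrpow_const p) (.inr hC)
        simpa [hp0] using this
      have h2 := ENNReal.Tendsto.mul_const (b := X) (h1.ennrpow_const a) (.inr hXtop)
      have h3 := ENNReal.Tendsto.const_mul (a := 2 ^ (q - 1)) h2 (.inr h2q)
      simpa [ha] using h3
    have hev := hlim.eventually_le_const (ENNReal.half_pos hη)
    obtain ⟨δ, ⟨h1, h2⟩, h3⟩ := (hev.and (Ioc_mem_nhdsGT hr)).exists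
      |>.imp fun δ h => (⟨h.2, h.1⟩ : (0 < δ ∧ δ ≤ r) ∧ _)
    exact ⟨δ, h1, h2, h3⟩
  let φ : ContDiffBump (0 : E) := ⟨δ / 2, δ, by linarith, by linarith⟩
  obtain ⟨K, hK, hKb⟩ := exists_enorm_translateAverage_bumpMeasure_le μ φ
  obtain ⟨σ, hσ, hση⟩ : ∃ σ : ℝ≥0∞, 0 < σ ∧ 2 ^ (q - 1) * ((K * σ) ^ (q - p) * C) ≤ η / 2 := by
    have hlim : Tendsto (fun σ : ℝ≥0∞ => 2 ^ (q - 1) * ((K * σ) ^ (q - p) * C))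
        (nhdsWithin 0 (Set.Ioi 0)) (nhds 0) := by
      have h1 : Tendsto (fun σ : ℝ≥0∞ => K * σ) (nhdsWithin 0 (Set.Ioi 0)) (nhds 0) := by
        have := ENNReal.Tendsto.const_mul (a := K) (tendsto_id (x := nhds (0 : ℝ≥0∞))) (.inr hK)
        rw [mul_zero] at this
        exact this.mono_left nhdsWithin_le_nhds
      have h2 := ENNReal.Tendsto.mul_const (b := C) (h1.ennrpow_const (q - p)) (.inr hC)
      have h3 := ENNReal.Tendsto.const_mul (a := 2 ^ (q - 1)) h2 (.inr h2q)
      simpa [hpq] using h3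
    have hev := hlim.eventually_le_const (ENNReal.half_pos hη)
    obtain ⟨σ, h1, h2⟩ := (hev.and self_mem_nhdsWithin).exists
    exact ⟨σ, h2, h1⟩
  refine ⟨σ, hσ, fun v hv hc hvC hdC hvσ => ?_⟩
  set ρ := bumpMeasure μ φ
  set w := translateAverage ρ v
  have hwc : Continuous w := (contDiff_translateAverage_bumpMeasure μ φ hv.continuous).continuous
  have hvm : Measurable v := hv.continuous.measurable
  have hvc : Continuous v := hv.continuous
  have hwM (x : E) : ‖w x‖ₑ ≤ K * σ :=
    (hKb v hvm x).trans (by gcongr; exact (lintegral_mono_set (ball_subset_ball hδr)).trans (hvσ x))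
  have hwq : ∫⁻ x, ‖w x‖ₑ ^ q ∂μ ≤ (K * σ) ^ (q - p) * C := by
    calc ∫⁻ x, ‖w x‖ₑ ^ q ∂μ ≤ ∫⁻ x, (K * σ) ^ (q - p) * ‖w x‖ₑ ^ p ∂μ := by
          refine lintegral_mono fun x => ?_
          have : q = (q - p) + p := by ring
          conv_lhs => rw [this]
          rw [ENNReal.rpow_add_of_nonneg _ _ (by linarith) hp0.le]
          gcongr
          exact hwM x
      _ = (K * σ) ^ (q - p) * ∫⁻ x, ‖w x‖ₑ ^ p ∂μ := lintegral_const_mul _ (by fun_prop)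
      _ ≤ (K * σ) ^ (q - p) * C := by
          gcongr
          exact (lintegral_translateAverage_rpow_le μ ρ hp hvm).trans hvC
  have hdp : ∫⁻ x, ‖v x - w x‖ₑ ^ p ∂μ ≤ ENNReal.ofReal δ ^ p * C :=
    (lintegral_sub_translateAverage_rpow_le μ (ae_bumpMeasure_norm_le μ φ) hp hv hc).trans
      (by gcongr)
  have hvs : ∫⁻ x, ‖v x‖ₑ ^ s ∂μ ≤ S * C ^ (s / p) :=
    (hSob v hv hc).trans (by gcongr)
  have hds : ∫⁻ x, ‖v x - w x‖ₑ ^ s ∂μ ≤ 2 ^ (s - 1) * (2 * (S * C ^ (s / p))) := by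
    calc ∫⁻ x, ‖v x - w x‖ₑ ^ s ∂μ
        ≤ ∫⁻ x, 2 ^ (s - 1) * (‖v x‖ₑ ^ s + ‖w x‖ₑ ^ s) ∂μ := by
          refine lintegral_mono fun x => ?_
          exact (ENNReal.rpow_le_rpow (enorm_sub_le) (by linarith)).trans
            (ENNReal.rpow_add_le_mul_rpow_add_rpow _ _ hs1)
      _ = 2 ^ (s - 1) * (∫⁻ x, ‖v x‖ₑ ^ s ∂μ + ∫⁻ x, ‖w x‖ₑ ^ s ∂μ) := by
          rw [lintegral_const_mul _ (by fun_prop), lintegral_add_left (by fun_prop)]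
      _ ≤ 2 ^ (s - 1) * (2 * (S * C ^ (s / p))) := by
          rw [two_mul]
          gcongr
          exact (lintegral_translateAverage_rpow_le μ ρ hs1 hvm).trans hvs
  have hdq : ∫⁻ x, ‖v x - w x‖ₑ ^ q ∂μ ≤ (ENNReal.ofReal δ ^ p * C) ^ a * X :=
    (lintegral_rpow_le_interpolation μ hp0 hpq hqs (by fun_prop)).trans
      (mul_le_mul' (ENNReal.rpow_le_rpow hdp ha.le) (ENNReal.rpow_le_rpow hds hb.le))
  calc ∫⁻ x, ‖v x‖ₑ ^ q ∂μ
      ≤ ∫⁻ x, 2 ^ (q - 1) * (‖w x‖ₑ ^ q + ‖v x - w x‖ₑ ^ q) ∂μ := by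
        refine lintegral_mono fun x => ?_
        refine le_trans ?_ (ENNReal.rpow_add_le_mul_rpow_add_rpow _ _ (by linarith))
        refine ENNReal.rpow_le_rpow ?_ (by linarith)
        simpa using enorm_add_le (w x) (v x - w x)
    _ = 2 ^ (q - 1) * ∫⁻ x, ‖w x‖ₑ ^ q ∂μ + 2 ^ (q - 1) * ∫⁻ x, ‖v x - w x‖ₑ ^ q ∂μ := by
        rw [lintegral_const_mul _ (by fun_prop), lintegral_add_left (by fun_prop), mul_add]
    _ ≤ η / 2 + η / 2 := by
        gcongr
        · exact le_trans (by gcongr) hση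
        · exact le_trans (by gcongr) hδη
    _ = η := ENNReal.add_halves η

/-- Quantitative vanishing lemma for Lipschitz functions. -/
theorem exists_lintegral_rpow_le_of_lipschitz (μ : Measure E) [μ.IsAddHaarMeasure] {p q s : ℝ}
    (hp : 1 ≤ p) (hpq : p < q) (hqs : q < s) (hn : 0 < Module.finrank ℝ E)
    (hps : s⁻¹ = p⁻¹ - (Module.finrank ℝ E : ℝ)⁻¹) {C : ℝ≥0∞} (hC : C ≠ ∞) {r : ℝ} (hr : 0 < r)
    {η : ℝ≥0∞} (hη : η ≠ 0) :
    ∃ σ : ℝ≥0∞, 0 < σ ∧ ∀ (u : E → ℝ) (L : ℝ≥0), LipschitzWith L u → HasCompactSupport u →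
      ∫⁻ x, ‖u x‖ₑ ^ p ∂μ ≤ C → ∫⁻ x, ‖fderiv ℝ u x‖ₑ ^ p ∂μ ≤ C →
      (∀ x, ∫⁻ z in ball x r, ‖u z‖ₑ ∂μ ≤ σ) → ∫⁻ x, ‖u x‖ₑ ^ q ∂μ ≤ η := by
  obtain ⟨σ, hσ, h⟩ := exists_lintegral_rpow_le_of_contDiff μ hp hpq hqs hn hps hC hr hη
  refine ⟨σ, hσ, fun u L hu hc huC hdC huσ => ?_⟩
  have hum : Measurable u := hu.continuous.measurable
  let φ (n : ℕ) : ContDiffBump (0 : E) :=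
    ⟨1 / ((n : ℝ) + 1) / 2, 1 / ((n : ℝ) + 1), by positivity, half_lt_self (by positivity)⟩
  let w (n : ℕ) : E → ℝ := translateAverage (bumpMeasure μ (φ n)) u
  have hw1 (n : ℕ) : ContDiff ℝ 1 (w n) :=
    contDiff_translateAverage_bumpMeasure μ (φ n) hu.continuous
  have hwq (n : ℕ) : ∫⁻ x, ‖w n x‖ₑ ^ q ∂μ ≤ η :=
    h (w n) (hw1 n) (hasCompactSupport_translateAverage_bumpMeasure μ (φ n) hc)
      ((lintegral_translateAverage_rpow_le μ _ hp hum).trans huC)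
      ((lintegral_fderiv_translateAverage_rpow_le μ (ρ := bumpMeasure μ (φ n))
        (withDensity_absolutelyContinuous _ _)
        hp hu hc).trans hdC)
      (setLIntegral_translateAverage_le hum huσ)
  have hlim (x : E) : Tendsto (fun n => ‖w n x‖ₑ ^ q) atTop (nhds (‖u x‖ₑ ^ q)) := by
    refine Tendsto.ennrpow_const q (Tendsto.enorm ?_)
    rw [tendsto_iff_norm_sub_tendsto_zero]
    refine squeeze_zero (fun _ => norm_nonneg _)
      (fun n => translateAverage_sub_le (ae_bumpMeasure_norm_le μ (φ n)) hu hc x) ?_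
    simpa [φ] using tendsto_one_div_add_atTop_nhds_zero_nat.const_mul (L : ℝ)
  calc ∫⁻ x, ‖u x‖ₑ ^ q ∂μ = ∫⁻ x, liminf (fun n => ‖w n x‖ₑ ^ q) atTop ∂μ := by
        simp only [(hlim _).liminf_eq]
    _ ≤ liminf (fun n => ∫⁻ x, ‖w n x‖ₑ ^ q ∂μ) atTop :=
        lintegral_liminf_le fun n => ((hw1 n).continuous.enorm.measurable.pow_const q)
    _ ≤ η := liminf_le_of_frequently_le' (.of_forall hwq)

end Averaging

/-- A separated set has uniformly boundedly many points in balls of a fixed radius. -/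
theorem exists_card_le_of_separated {E : Type*} [NormedAddCommGroup E] [ProperSpace E]
    {Γ : Set E} {ε : ℝ} (hε : 0 < ε) (hΓ : ∀ y ∈ Γ, ∀ y' ∈ Γ, y ≠ y' → ε ≤ dist y y') (R : ℝ) :
    ∃ N : ℕ, ∀ x, (Γ ∩ ball x R).Finite ∧ (Γ ∩ ball x R).ncard ≤ N := by
  obtain ⟨t, -, ht, hcov⟩ := (isCompact_closedBall (0 : E) R).finite_cover_balls (half_pos hε)
  refine ⟨t.ncard, fun x => ?_⟩
  have hc (y : E) (hy : y ∈ Γ ∩ ball x R) : ∃ c ∈ t, dist (y - x) c < ε / 2 := by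
    have : y - x ∈ closedBall (0 : E) R := by
      simpa [dist_eq_norm] using (mem_ball.1 hy.2).le
    simpa using hcov this
  choose! c hct hcd using hc
  have hinj : Set.InjOn c (Γ ∩ ball x R) := by
    intro y hy z hz hyz
    by_contra hne
    have h1 := hΓ y hy.1 z hz.1 hne
    have h2 := hcd y hy
    have h3 := hcd z hz
    rw [hyz] at h2
    have h4 := dist_triangle_right (y - x) (z - x) (c z)
    rw [dist_sub_right] at h4
    linarith
  exact ⟨Set.Finite.of_finite_image (ht.subset (Set.image_subset_iff.2 hct)) hinj,
    Set.ncard_le_ncard_of_injOn c hct hinj ht⟩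

/-- Bounds on the balls of a discretization imply bounds on all balls of the same radius. -/
theorem IsDiscretization.exists_setLIntegral_ball_le {m : ℕ} {ε : ℝ} {ν : ℕ}
    {Γ : Set (EuclideanSpace ℝ (Fin m))} (hΓ : IsDiscretization m ε ν Γ) (hε : 0 < ε) :
    ∃ N : ℕ, ∀ (f : EuclideanSpace ℝ (Fin m) → ℝ≥0∞) (σ : ℝ≥0∞),
      (∀ y ∈ Γ, ∫⁻ z in ball y (ν * ε), f z ≤ σ) →
        ∀ x, ∫⁻ z in ball x (ν * ε), f z ≤ N * σ := by
  obtain ⟨N, hN⟩ := exists_card_le_of_separated hε hΓ.1 (ν * ε + ν * ε)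
  refine ⟨N, fun f σ hf x => ?_⟩
  obtain ⟨hfin, hcard⟩ := hN x
  set T := hfin.toFinset with hT
  have hsub : ball x (ν * ε) ⊆ ⋃ y ∈ T, ball y (ν * ε) := by
    intro z hz
    obtain ⟨y, hy, hzy⟩ := hΓ.2 z
    simp only [Set.mem_iUnion]
    refine ⟨y, ?_, hzy⟩
    rw [hT, Set.Finite.mem_toFinset]
    refine ⟨hy, ?_⟩
    rw [mem_ball] at *
    linarith [dist_triangle_left y x z]
  calc ∫⁻ z in ball x (ν * ε), f z ≤ ∫⁻ z in ⋃ y ∈ T, ball y (ν * ε), f z :=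
        lintegral_mono_set hsub
    _ ≤ ∑ y ∈ T, ∫⁻ z in ball y (ν * ε), f z := by
        rw [← Set.iUnion_subtype (· ∈ T) fun y => ball y.1 (ν * ε), ← Finset.sum_coe_sort,
          ← tsum_fintype (L := .unconditional _)]
        exact lintegral_iUnion_le _ f
    _ ≤ ∑ _y ∈ T, σ := Finset.sum_le_sum fun y hy => hf y ((Set.Finite.mem_toFinset _).1 hy).1
    _ = (T.card : ℝ≥0∞) * σ := by simp
    _ ≤ N * σ := by
        rw [Set.ncard_eq_toFinset_card _ hfin] at hcard
        gcongr

/-- A bounded measurable function with compact support is integrable. -/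
theorem integrable_of_hasCompactSupport_of_bound {E F : Type*} [TopologicalSpace E]
    [R1Space E] [MeasurableSpace E] [BorelSpace E] [NormedAddCommGroup F] {μ : Measure E}
    [IsFiniteMeasureOnCompacts μ] {f : E → F} (hc : HasCompactSupport f)
    (hf : AEStronglyMeasurable f μ) (C : ℝ) (hC : ∀ x, ‖f x‖ ≤ C) : Integrable f μ :=
  (integrableOn_iff_integrable_of_support_subset (subset_tsupport f)).1
    (Measure.integrableOn_of_bounded hc.isCompact.measure_lt_top.ne hf (.of_forall hC))

theorem lintegral_rpow_le_ofReal_Ep {m : ℕ} {p : ℝ} (hp : 0 < p)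
    {u : EuclideanSpace ℝ (Fin m) → ℝ} {L : ℝ≥0} (hu : LipschitzWith L u)
    (hc : HasCompactSupport u) :
    ∫⁻ x, ‖u x‖ₑ ^ p ≤ ENNReal.ofReal (Ep m p u) ∧
      ∫⁻ x, ‖fderiv ℝ u x‖ₑ ^ p ≤ ENNReal.ofReal (Ep m p u) := by
  have hm := measurable_fderiv ℝ u
  have h1 : Integrable fun x => ‖fderiv ℝ u x‖ ^ p := by
    refine integrable_of_hasCompactSupport_of_bound
      ((hc.fderiv ℝ).comp_left (g := fun y => ‖y‖ ^ p) (by simp [hp.ne']))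
      (hm.norm.pow_const p).aestronglyMeasurable ((L : ℝ) ^ p) fun x => ?_
    rw [Real.norm_of_nonneg (by positivity)]
    exact Real.rpow_le_rpow (norm_nonneg _) (norm_fderiv_le_of_lipschitz ℝ hu) hp.le
  have h2 : Integrable fun x => |u x| ^ p :=
    Continuous.integrable_of_hasCompactSupport
      ((continuous_abs.comp hu.continuous).rpow_const fun _ => .inr hp.le)
      (hc.comp_left (g := fun y => |y| ^ p) (by simp [hp.ne']))
  rw [Ep, ofReal_integral_eq_lintegral_ofReal (Integrable.fun_add h1 h2) (.of_forall fun x => by positivity)]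
  constructor <;> refine lintegral_mono fun x => ?_
  · rw [← ofReal_norm, ENNReal.ofReal_rpow_of_nonneg (norm_nonneg _) hp.le, Real.norm_eq_abs]
    exact ENNReal.ofReal_le_ofReal (le_add_of_nonneg_left (by positivity))
  · rw [← ofReal_norm, ENNReal.ofReal_rpow_of_nonneg (norm_nonneg _) hp.le]
    exact ENNReal.ofReal_le_ofReal (le_add_of_nonneg_right (by positivity))

theorem ofReal_integral_abs_rpow {α : Type*} [MeasurableSpace α] {μ : Measure α} {u : α → ℝ}
    {q : ℝ} (hq : 0 ≤ q) (hu : Integrable (fun x => |u x| ^ q) μ) :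
    ENNReal.ofReal (∫ x, |u x| ^ q ∂μ) = ∫⁻ x, ‖u x‖ₑ ^ q ∂μ := by
  rw [ofReal_integral_eq_lintegral_ofReal hu (.of_forall fun x => by positivity)]
  simp only [← ofReal_norm, Real.norm_eq_abs, ENNReal.ofReal_rpow_of_nonneg (abs_nonneg _) hq]

theorem setLIntegral_enorm_le_rpow {α : Type*} [MeasurableSpace α] {μ : Measure α} {u : α → ℝ}
    (hu : Measurable u) {q : ℝ} (hq : 1 ≤ q) (s : Set α) :
    ∫⁻ x in s, ‖u x‖ₑ ∂μ ≤ (∫⁻ x, ‖u x‖ₑ ^ q ∂μ) ^ q⁻¹ * μ s ^ (1 - q⁻¹) := by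
  have h := eLpNorm'_le_eLpNorm'_mul_rpow_measure_univ (μ := μ.restrict s) one_pos hq
    hu.aestronglyMeasurable
  simp only [eLpNorm', ENNReal.rpow_one, div_one, one_div, Measure.restrict_apply_univ]
    at h
  refine h.trans ?_
  gcongr
  exact Measure.restrict_le_self

/-- (Spotlight lemma, Euclidean case.) For a bounded sequence in `H^{1,p}(ℝ^m)`
of compactly supported Lipschitz functions, `∫|u_k|^q → 0` (`p < q < p*`) iff
`∫_{B(y_k,νε)}|u_k| → 0` for every sequence `(y_k)` in an `(ε,ν)`-discretization `Γ`. -/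
theorem stmt4 (m : ℕ) (hm : 2 ≤ m) (p q : ℝ) (hp : 1 < p) (hpm : p < m)
    (hq1 : p < q) (hq2 : q < m * p / (m - p))
    (ε : ℝ) (hε : 0 < ε) (ν : ℕ) (hν : 1 ≤ ν)
    (Γ : Set (EuclideanSpace ℝ (Fin m))) (hΓ : IsDiscretization m ε ν Γ)
    (u : ℕ → EuclideanSpace ℝ (Fin m) → ℝ)
    (hlip : ∀ k, ∃ L : ℝ≥0, LipschitzWith L (u k))
    (hsupp : ∀ k, HasCompactSupport (u k))
    (hbdd : ∃ C : ℝ, ∀ k, Ep m p (u k) ≤ C) :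
    Tendsto (fun k => ∫ x, |u k x| ^ q) atTop (nhds 0) ↔
      ∀ y : ℕ → EuclideanSpace ℝ (Fin m), (∀ k, y k ∈ Γ) →
        Tendsto (fun k => ∫ x in ball (y k) (ν * ε), |u k x|) atTop (nhds 0) := by
  have hp0 : 0 < p := by linarith
  have hq0 : 0 < q := by linarith
  have hm0 : (0 : ℝ) < m := by linarith
  have hr : 0 < (ν : ℝ) * ε := mul_pos (by exact_mod_cast hν) hε
  choose L hL using hlip
  have hum (k : ℕ) : Measurable (u k) := (hL k).continuous.measurable
  have hint (k : ℕ) {t : ℝ} (ht : 0 < t) : Integrable fun x => |u k x| ^ t :=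
    Continuous.integrable_of_hasCompactSupport
      ((continuous_abs.comp (hL k).continuous).rpow_const fun _ => .inr ht.le)
      ((hsupp k).comp_left (g := fun y => |y| ^ t) (by simp [ht.ne']))
  have hball (k : ℕ) (y : EuclideanSpace ℝ (Fin m)) :
      ENNReal.ofReal (∫ x in ball y (ν * ε), |u k x|) = ∫⁻ x in ball y (ν * ε), ‖u k x‖ₑ := by
    have h : Integrable fun x => |u k x| ^ (1 : ℝ) := hint k one_pos
    simpa using ofReal_integral_abs_rpow zero_le_one h.restrict
  constructor
  · intro h y _
    have h0 : Tendsto (fun k => ∫⁻ x, ‖u k x‖ₑ ^ q) atTop (nhds 0) := by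
      have := ENNReal.tendsto_ofReal h
      simpa only [ofReal_integral_abs_rpow hq0.le (hint _ hq0), ENNReal.ofReal_zero] using this
    have hvol : volume (ball (0 : EuclideanSpace ℝ (Fin m)) (ν * ε)) ^ (1 - q⁻¹) ≠ ∞ :=
      ENNReal.rpow_ne_top_of_nonneg (sub_nonneg.2 (inv_le_one_of_one_le₀ (by linarith)))
        measure_ball_lt_top.ne
    have h1 : Tendsto (fun k => ∫⁻ x in ball (y k) (ν * ε), ‖u k x‖ₑ) atTop (nhds 0) := by
      refine tendsto_of_tendsto_of_tendsto_of_le_of_le tendsto_const_nhds ?_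
        (fun _ => zero_le) fun k =>
        (setLIntegral_enorm_le_rpow (hum k) (by linarith : 1 ≤ q) (ball (y k) (ν * ε))).trans
          (by rw [Measure.addHaar_ball_center])
      simpa [hq0] using ENNReal.Tendsto.mul_const (h0.ennrpow_const q⁻¹) (.inr hvol)
    simp only [← hball] at h1
    have h2 := (ENNReal.tendsto_toReal ENNReal.zero_ne_top).comp h1
    refine h2.congr fun k => ?_
    exact ENNReal.toReal_ofReal (integral_nonneg fun x => abs_nonneg _)
  · intro h
    obtain ⟨C, hC⟩ := hbdd
    have hmp : 0 < (m : ℝ) - p := by linarith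
    obtain ⟨N, hN⟩ := hΓ.exists_setLIntegral_ball_le hε
    have h0 : Tendsto (fun k => ∫⁻ x, ‖u k x‖ₑ ^ q) atTop (nhds 0) := by
      rw [ENNReal.tendsto_nhds_zero]
      intro η hη
      obtain ⟨σ, hσ, hσu⟩ := exists_lintegral_rpow_le_of_lipschitz
        (volume : Measure (EuclideanSpace ℝ (Fin m))) hp.le hq1 hq2 (by simp; omega)
        (by rw [finrank_euclideanSpace_fin]; field_simp) (C := ENNReal.ofReal C) (by simp) hr hη.ne'
      obtain ⟨τ, hτ, hτσ⟩ : ∃ τ : ℝ, 0 < τ ∧ (N : ℝ≥0∞) * ENNReal.ofReal τ ≤ σ := by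
        obtain ⟨τ, hτ, hτσ⟩ := ENNReal.exists_nnreal_pos_mul_lt (ENNReal.natCast_ne_top N) hσ.ne'
        exact ⟨τ, by exact_mod_cast hτ, by simpa [mul_comm] using hτσ.le⟩
      have hev : ∀ᶠ k in atTop, ∀ y ∈ Γ, ∫ x in ball y (ν * ε), |u k x| < τ := by
        have hex (k : ℕ) : ∃ y ∈ Γ, (∃ y' ∈ Γ, τ ≤ ∫ x in ball y' (ν * ε), |u k x|) →
            τ ≤ ∫ x in ball y (ν * ε), |u k x| := by
          by_cases hk : ∃ y' ∈ Γ, τ ≤ ∫ x in ball y' (ν * ε), |u k x|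
          · obtain ⟨y', hy', hy⟩ := hk
            exact ⟨y', hy', fun _ => hy⟩
          · obtain ⟨y, hy, -⟩ := hΓ.2 0
            exact ⟨y, hy, fun h => absurd h hk⟩
        choose y hy hyτ using hex
        filter_upwards [(h y hy).eventually_lt_const hτ] with k hk y' hy'
        by_contra! hcon
        exact absurd (hyτ k ⟨y', hy', hcon⟩) (not_le.2 hk)
      filter_upwards [hev] with k hk
      obtain ⟨h1, h2⟩ := lintegral_rpow_le_ofReal_Ep hp0 (hL k) (hsupp k)
      have hEp := ENNReal.ofReal_le_ofReal (hC k)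
      refine hσu (u k) (L k) (hL k) (hsupp k) (h1.trans hEp) (h2.trans hEp) fun x => ?_
      refine (hN _ (ENNReal.ofReal τ) (fun y hy => ?_) x).trans hτσ
      rw [← hball]
      exact ENNReal.ofReal_le_ofReal (hk y hy).le
    have h2 := (ENNReal.tendsto_toReal ENNReal.zero_ne_top).comp h0
    refine h2.congr fun k => ?_
    rw [Function.comp_apply, ← ofReal_integral_abs_rpow hq0.le (hint k hq0)]
    exact ENNReal.toReal_ofReal (integral_nonneg fun x => by positivity)
end

section
/- Let m ≥ 2, 1 < p < m, q ∈ (p, p*), ε > 0, let ν ≥ 1 be an integer, and let Γ ⊆ ℝ^m be an (ε,ν)-discretization of ℝ^m. Then there exists a constant C > 0 such that for every compactly supported Lipschitz function u : ℝ^m → ℝ one has ∫_{ℝ^m}|u|^q dx ≤ C · E_p(u) · ( sup_{y∈Γ} ∫_{B(y,νε)} |u|^q dx )^{1−p/q}. -/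
open MeasureTheory Metric Filter
open scoped NNReal ENNReal

theorem Set.Pairwise.pairwiseDisjoint_ball_half {X : Type*} [PseudoMetricSpace X] {Γ : Set X}
    {ε : ℝ} (hΓ : Γ.Pairwise fun y y' => ε ≤ dist y y') :
    Pairwise (Function.onFun Disjoint fun y : Γ => ball (y : X) (ε / 2)) := fun y y' h =>
  ball_disjoint_ball (by linarith [hΓ y.2 y'.2 (Subtype.coe_injective.ne h)])

/-- Summing a local inequality over a countable cover by balls with bounded overlap. -/
theorem lintegral_le_of_ball_cover {X : Type*} [PseudoMetricSpace X] [MeasurableSpace X]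
    [OpensMeasurableSpace X] (μ : Measure X) {Γ : Set X} [Countable Γ] {R r : ℝ} {N K A : ℝ≥0∞}
    (hcov : ∀ x : X, ∃ y ∈ Γ, x ∈ ball y R)
    (hN : ∀ x : X, ∑' y : Γ, (closedBall (y : X) r).indicator (1 : X → ℝ≥0∞) x ≤ N)
    {g f : X → ℝ≥0∞} (hf : Measurable f) {θ : ℝ} (hθ0 : 0 ≤ θ) (hθ1 : θ ≤ 1)
    (hA : ∀ y ∈ Γ, ∫⁻ x in ball y R, g x ∂μ ≤ A)
    (hloc : ∀ y ∈ Γ, (∫⁻ x in ball y R, g x ∂μ) ^ θ ≤ K * ∫⁻ x in closedBall y r, f x ∂μ) :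
    ∫⁻ x, g x ∂μ ≤ A ^ (1 - θ) * (K * (N * ∫⁻ x, f x ∂μ)) := by
  have huniv : (⋃ y : Γ, ball (y : X) R) = Set.univ :=
    Set.eq_univ_of_forall fun x => by
      obtain ⟨y, hy, hx⟩ := hcov x
      exact Set.mem_iUnion.2 ⟨⟨y, hy⟩, hx⟩
  calc ∫⁻ x, g x ∂μ = ∫⁻ x in ⋃ y : Γ, ball (y : X) R, g x ∂μ := by
        rw [huniv, Measure.restrict_univ]
    _ ≤ ∑' y : Γ, ∫⁻ x in ball (y : X) R, g x ∂μ := lintegral_iUnion_le _ _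
    _ ≤ ∑' y : Γ, A ^ (1 - θ) * (K * ∫⁻ x in closedBall (y : X) r, f x ∂μ) := by
        refine ENNReal.tsum_le_tsum fun y => ?_
        calc ∫⁻ x in ball (y : X) R, g x ∂μ
            = (∫⁻ x in ball (y : X) R, g x ∂μ) ^ (1 - θ) *
                (∫⁻ x in ball (y : X) R, g x ∂μ) ^ θ := by
              rw [← ENNReal.rpow_add_of_nonneg _ _ (sub_nonneg.2 hθ1) hθ0, sub_add_cancel,
                ENNReal.rpow_one]
          _ ≤ _ := mul_le_mul' (ENNReal.rpow_le_rpow (hA y y.2) (sub_nonneg.2 hθ1)) (hloc y y.2)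
    _ = A ^ (1 - θ) * (K * ∫⁻ x, ∑' y : Γ, (closedBall (y : X) r).indicator f x ∂μ) := by
        rw [ENNReal.tsum_mul_left, ENNReal.tsum_mul_left, lintegral_tsum fun y =>
          (hf.indicator measurableSet_closedBall).aemeasurable]
        simp_rw [lintegral_indicator measurableSet_closedBall]
    _ ≤ A ^ (1 - θ) * (K * ∫⁻ x, N * f x ∂μ) := by
        gcongr with x
        refine le_trans (le_of_eq ?_) (mul_le_mul_left (hN x) (f x))
        rw [← ENNReal.tsum_mul_right]
        refine tsum_congr fun y => ?_
        by_cases hx : x ∈ closedBall (y : X) r <;> simp [Set.indicator, hx]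
    _ = _ := by rw [lintegral_const_mul _ hf]

section LipschitzSobolev

open scoped Topology Convolution Pointwise
open ContinuousLinearMap (lsmul)

variable {E : Type*} [NormedAddCommGroup E] [InnerProductSpace ℝ E] [FiniteDimensional ℝ E]
  [MeasurableSpace E] [BorelSpace E] (μ : Measure E) [μ.IsAddHaarMeasure]

/-- The derivative of the mollification of a Lipschitz function is the mollification of its
almost everywhere defined derivative. -/
theorem LipschitzWith.hasFDerivAt_normed_convolution {u : E → ℝ} {L : ℝ≥0}
    (hu : LipschitzWith L u) (φ : ContDiffBump (0 : E)) (x : E) :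
    HasFDerivAt (φ.normed μ ⋆[lsmul ℝ ℝ, μ] u)
      ((φ.normed μ ⋆[lsmul ℝ ℝ, μ] fderiv ℝ u) x) x := by
  refine (hasFDerivAt_integral_of_dominated_loc_of_lip (s := Set.univ)
    (bound := fun t => φ.normed μ t * L) Filter.univ_mem ?_ ?_ ?_ ?_ ?_ ?_).2
  · filter_upwards with z
    exact (φ.continuous_normed.mul
      (hu.continuous.comp (continuous_const.sub continuous_id))).aestronglyMeasurable
  · exact (φ.continuous_normed.mul
      (hu.continuous.comp (continuous_const.sub continuous_id))).integrable_of_hasCompactSupport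
      φ.hasCompactSupport_normed.mul_right
  · exact φ.continuous_normed.aestronglyMeasurable.smul
      ((measurable_fderiv ℝ u).comp (measurable_const.sub measurable_id)).aestronglyMeasurable
  · filter_upwards with t
    refine LipschitzOnWith.of_dist_le_mul fun y _ z _ => ?_
    have h0 : 0 ≤ φ.normed μ t := φ.nonneg_normed t
    have h := hu.dist_le_mul (y - t) (z - t)
    simp only [ContinuousLinearMap.lsmul_apply, smul_eq_mul, Real.coe_nnabs, dist_sub_right] at h ⊢
    rw [Real.dist_eq, ← mul_sub, abs_mul, abs_of_nonneg h0,
      abs_of_nonneg (mul_nonneg h0 L.coe_nonneg), mul_assoc]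
    exact mul_le_mul_of_nonneg_left h h0
  · exact φ.integrable_normed.mul_const _
  · have hd : ∀ᵐ t ∂μ, DifferentiableAt ℝ u (x - t) :=
      (quasiMeasurePreserving_sub_left_of_right_invariant μ x).ae hu.ae_differentiableAt
    filter_upwards [hd] with t ht
    have h := ht.hasFDerivAt.comp x ((hasFDerivAt_id x).sub (hasFDerivAt_const t x))
    simp only [sub_zero, ContinuousLinearMap.comp_id] at h
    exact h.const_smul (φ.normed μ t)

/-- The **Sobolev inequality** for Lipschitz functions supported in a fixed bounded set. -/
theorem LipschitzWith.eLpNorm_le_eLpNorm_fderiv_of_le {u : E → ℝ} {L : ℝ≥0}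
    (hu : LipschitzWith L u) {s : Set E} (hs : Bornology.IsBounded s)
    (hus : Function.support u ⊆ s) {p q : ℝ≥0} (hp : 1 ≤ p) (hpn : p < Module.finrank ℝ E)
    (hpq : (p : ℝ)⁻¹ - (Module.finrank ℝ E : ℝ)⁻¹ ≤ (q : ℝ)⁻¹) :
    eLpNorm u q μ ≤
      eLpNormLESNormFDerivOfLeConst ℝ μ (ball (0 : E) 1 + s) p q * eLpNorm (fderiv ℝ u) p μ := by
  set C : ℝ≥0 := eLpNormLESNormFDerivOfLeConst ℝ μ (ball (0 : E) 1 + s) p q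
  have hs' : Bornology.IsBounded (ball (0 : E) 1 + s) := isBounded_ball.add hs
  have hp0 : (0 : ℝ) < p := zero_lt_one.trans_le hp
  let φ : ℕ → ContDiffBump (0 : E) := fun n =>
    ⟨1 / (2 * ((n : ℝ) + 1)), 1 / ((n : ℝ) + 1), by positivity, by
      have : (0 : ℝ) < (n : ℝ) + 1 := by positivity
      gcongr; linarith⟩
  have hφ : Tendsto (fun n => (φ n).rOut) atTop (𝓝 0) := tendsto_one_div_add_atTop_nhds_zero_nat
  have hφ1 (n : ℕ) : (φ n).rOut ≤ 1 := by
    change 1 / ((n : ℝ) + 1) ≤ 1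
    rw [div_le_one (by positivity)]
    simp
  have hφ2 (n : ℕ) : (φ n).rOut ≤ 2 * (φ n).rIn := by
    change 1 / ((n : ℝ) + 1) ≤ 2 * (1 / (2 * ((n : ℝ) + 1)))
    apply le_of_eq
    field_simp
  have hDL (x : E) : ‖fderiv ℝ u x‖ ≤ L := norm_fderiv_le_of_lipschitz ℝ hu
  have hDint : LocallyIntegrable (fderiv ℝ u) μ := by
    refine (locallyIntegrable_const (L : ℝ)).mono
      (measurable_fderiv ℝ u).aestronglyMeasurable (ae_of_all _ fun x => ?_)
    simpa using hDL x
  let v : ℕ → E → ℝ := fun n => (φ n).normed μ ⋆[lsmul ℝ ℝ, μ] u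
  have hv (n : ℕ) : ContDiff ℝ 1 (v n) :=
    (φ n).hasCompactSupport_normed.contDiff_convolution_left _ (φ n).contDiff_normed
      hu.continuous.locallyIntegrable
  have hvs (n : ℕ) : Function.support (v n) ⊆ ball (0 : E) 1 + s := by
    refine (support_convolution_subset _).trans (Set.add_subset_add ?_ hus)
    rw [(φ n).support_normed_eq]
    exact ball_subset_ball (hφ1 n)
  have hDv (n : ℕ) : fderiv ℝ (v n) = (φ n).normed μ ⋆[lsmul ℝ ℝ, μ] fderiv ℝ u :=
    funext fun x => (hu.hasFDerivAt_normed_convolution μ (φ n) x).fderiv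
  have hDvL (n : ℕ) (x : E) : ‖fderiv ℝ (v n) x‖ₑ ≤ L := by
    have h := norm_integral_le_of_norm_le
      (f := fun t => (φ n).normed μ t • fderiv ℝ u (x - t)) (μ := μ)
      ((φ n).integrable_normed.mul_const (L : ℝ)) (ae_of_all _ fun t => by
        rw [norm_smul, Real.norm_of_nonneg ((φ n).nonneg_normed t)]
        exact mul_le_mul_of_nonneg_left (hDL _) ((φ n).nonneg_normed t))
    rw [integral_mul_const, (φ n).integral_normed, one_mul] at h
    rw [hDv]
    exact enorm_le_coe.2 h
  have hDvs (n : ℕ) (x : E) (hx : x ∉ closure (ball (0 : E) 1 + s)) : fderiv ℝ (v n) x = 0 :=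
    Function.notMem_support.1 fun h =>
      hx (closure_mono (hvs n) (support_fderiv_subset ℝ h))
  have hlim : Tendsto (fun n => ∫⁻ x, ‖fderiv ℝ (v n) x‖ₑ ^ (p : ℝ) ∂μ) atTop
      (𝓝 (∫⁻ x, ‖fderiv ℝ u x‖ₑ ^ (p : ℝ) ∂μ)) := by
    refine tendsto_lintegral_of_dominated_convergence
      ((closure (ball (0 : E) 1 + s)).indicator fun _ => (L : ℝ≥0∞) ^ (p : ℝ)) (fun n => ?_)
      (fun n => ae_of_all _ fun x => ?_) ?_ ?_
    · exact ((hv n).continuous_fderiv one_ne_zero).measurable.enorm.pow_const _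
    · by_cases hx : x ∈ closure (ball (0 : E) 1 + s)
      · rw [Set.indicator_of_mem hx]
        exact ENNReal.rpow_le_rpow (hDvL n x) hp0.le
      · have h0 : ‖fderiv ℝ (v n) x‖ₑ = 0 := by rw [hDvs n x hx]; exact enorm_zero (E := E →L[ℝ] ℝ)
        simp [h0, hp0]
    · rw [lintegral_indicator_const isClosed_closure.measurableSet]
      exact ENNReal.mul_ne_top (ENNReal.rpow_ne_top_of_nonneg hp0.le ENNReal.coe_ne_top)
        hs'.closure.measure_lt_top.ne
    · filter_upwards [ContDiffBump.ae_convolution_tendsto_right_of_locallyIntegrable hφ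
        (Eventually.of_forall hφ2) hDint] with x hx
      simp only [hDv]
      exact (ENNReal.continuous_rpow_const.tendsto _).comp hx.enorm
  have hp00 : (p : ℝ≥0∞) ≠ 0 := by
    have : p ≠ 0 := (zero_lt_one.trans_le hp).ne'
    exact_mod_cast this
  have hlim' : Tendsto (fun n => C * eLpNorm (fderiv ℝ (v n)) p μ) atTop
      (𝓝 (C * eLpNorm (fderiv ℝ u) p μ)) := by
    refine ENNReal.Tendsto.const_mul ?_ (Or.inr ENNReal.coe_ne_top)
    simp only [eLpNorm_eq_lintegral_rpow_enorm_toReal hp00 ENNReal.coe_ne_top,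
      ENNReal.coe_toReal]
    exact (ENNReal.continuous_rpow_const.tendsto _).comp hlim
  calc eLpNorm u q μ ≤ atTop.liminf fun n => eLpNorm (v n) q μ :=
        Lp.eLpNorm_lim_le_liminf_eLpNorm (fun n => (hv n).continuous.aestronglyMeasurable) u
          (ae_of_all _ fun x =>
            ContDiffBump.convolution_tendsto_right_of_continuous hφ hu.continuous x)
    _ ≤ atTop.liminf fun n => C * eLpNorm (fderiv ℝ (v n)) p μ :=
        liminf_le_liminf (Eventually.of_forall fun n =>
          MeasureTheory.eLpNorm_le_eLpNorm_fderiv_of_le μ (hv n) (hvs n) hp hpn hpq hs')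
    _ = C * eLpNorm (fderiv ℝ u) p μ := hlim'.liminf_eq

/-- A local Sobolev inequality on balls centered at the origin. -/
theorem LipschitzWith.exists_lintegral_ball_zero_rpow_le {p q : ℝ≥0} (hp : 1 ≤ p)
    (hpn : p < Module.finrank ℝ E) (hq : 0 < q)
    (hpq : (p : ℝ)⁻¹ - (Module.finrank ℝ E : ℝ)⁻¹ ≤ (q : ℝ)⁻¹) {R : ℝ} (hR : 0 < R) :
    ∃ K : ℝ≥0, ∀ (u : E → ℝ) (L : ℝ≥0) (B : ℝ), LipschitzWith L u → (∀ x, ‖u x‖ ≤ B) →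
      (∫⁻ x in ball (0 : E) R, ‖u x‖ₑ ^ (q : ℝ) ∂μ) ^ ((p : ℝ) / q) ≤
        K * ∫⁻ x in closedBall (0 : E) (2 * R),
          (‖fderiv ℝ u x‖ₑ ^ (p : ℝ) + ‖u x‖ₑ ^ (p : ℝ)) ∂μ := by
  have hp0 : (0 : ℝ) < p := zero_lt_one.trans_le hp
  have hp1 : (1 : ℝ) ≤ p := hp
  have hq0 : (0 : ℝ) < q := hq
  let φ : ContDiffBump (0 : E) := ⟨R, 2 * R, hR, by linarith⟩
  have hφd : ContDiff ℝ 1 φ := φ.contDiff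
  obtain ⟨M, hM⟩ := hφd.lipschitzWith_of_hasCompactSupport φ.hasCompactSupport one_ne_zero
  let C : ℝ≥0 := eLpNormLESNormFDerivOfLeConst ℝ μ (ball (0 : E) 1 + ball 0 (2 * R)) p q
  refine ⟨C ^ (p : ℝ) * (2 ^ ((p : ℝ) - 1) * (max 1 M) ^ (p : ℝ)), fun u L B hu hB => ?_⟩
  let v : E → ℝ := fun x => φ x * u x
  have hB0 : 0 ≤ B := (norm_nonneg _).trans (hB 0)
  have hv : LipschitzWith (L + B.toNNReal * M) v := by
    refine LipschitzWith.of_dist_le_mul fun x y => ?_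
    have h1 := hu.dist_le_mul x y
    have h2 := hM.dist_le_mul x y
    rw [Real.dist_eq] at h1 h2 ⊢
    have h3 : |φ x| ≤ 1 := by rw [abs_of_nonneg φ.nonneg]; exact φ.le_one
    have h4 : |u y| ≤ B := hB y
    calc |φ x * u x - φ y * u y| = |φ x * (u x - u y) + u y * (φ x - φ y)| := by ring_nf
      _ ≤ |φ x| * |u x - u y| + |u y| * |φ x - φ y| := by
        rw [← abs_mul, ← abs_mul]; exact abs_add_le _ _
      _ ≤ 1 * (L * dist x y) + B * (M * dist x y) := by gcongr
      _ = ↑(L + B.toNNReal * M) * dist x y := by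
        push_cast
        rw [Real.coe_toNNReal B hB0]
        ring
  have hvs : Function.support v ⊆ ball 0 (2 * R) := fun x hx => by
    have h : x ∈ Function.support φ := left_ne_zero_of_mul hx
    rwa [φ.support_eq] at h
  have hDv : ∀ᵐ x ∂μ, ‖fderiv ℝ v x‖ₑ ^ (p : ℝ) ≤ (closedBall (0 : E) (2 * R)).indicator
      (fun x => (2 ^ ((p : ℝ) - 1) * (↑(max 1 M) : ℝ≥0∞) ^ (p : ℝ)) *
        (‖fderiv ℝ u x‖ₑ ^ (p : ℝ) + ‖u x‖ₑ ^ (p : ℝ))) x := by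
    filter_upwards [hu.ae_differentiableAt] with x hx
    by_cases hxs : x ∈ closedBall (0 : E) (2 * R)
    · rw [Set.indicator_of_mem hxs]
      have hle : ‖fderiv ℝ v x‖ₑ ≤ ‖fderiv ℝ u x‖ₑ + M * ‖u x‖ₑ := by
        have hd := ((hφd.differentiable one_ne_zero x).hasFDerivAt.mul hx.hasFDerivAt).fderiv
        change fderiv ℝ v x = _ at hd
        rw [hd]
        refine (enorm_add_le (E := E →L[ℝ] ℝ) _ _).trans ?_
        rw [enorm_smul, enorm_smul, mul_comm ‖u x‖ₑ]
        gcongr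
        · refine mul_le_of_le_one_left' ?_
          rw [Real.enorm_eq_ofReal φ.nonneg]
          exact ENNReal.ofReal_le_one.2 φ.le_one
        · exact enorm_le_coe.2 (norm_fderiv_le_of_lipschitz ℝ hM)
      calc ‖fderiv ℝ v x‖ₑ ^ (p : ℝ)
          ≤ (↑(max 1 M) * ‖fderiv ℝ u x‖ₑ + ↑(max 1 M) * ‖u x‖ₑ) ^ (p : ℝ) := by
            gcongr
            refine hle.trans ?_
            gcongr
            · exact le_mul_of_one_le_left' (by exact_mod_cast le_max_left 1 M)
            · exact le_max_right _ _
        _ ≤ _ := by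
            rw [← mul_add, ENNReal.mul_rpow_of_nonneg _ _ hp0.le,
              mul_comm (2 ^ ((p : ℝ) - 1)), mul_assoc]
            refine mul_le_mul_right ?_ _
            exact ENNReal.rpow_add_le_mul_rpow_add_rpow _ _ hp1
    · rw [Set.indicator_of_notMem hxs]
      have : fderiv ℝ v x = 0 := Function.notMem_support.1 fun h =>
        hxs (closure_ball_subset_closedBall (closure_mono hvs (support_fderiv_subset ℝ h)))
      have h0 : ‖fderiv ℝ v x‖ₑ = 0 := by rw [this]; exact enorm_zero (E := E →L[ℝ] ℝ)
      simp [h0, hp0]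
  have hS := hv.eLpNorm_le_eLpNorm_fderiv_of_le μ isBounded_ball hvs hp hpn hpq
  have hp00 : (p : ℝ≥0∞) ≠ 0 := by simpa using (zero_lt_one.trans_le hp).ne'
  have hq00 : (q : ℝ≥0∞) ≠ 0 := by simpa using hq.ne'
  rw [eLpNorm_eq_lintegral_rpow_enorm_toReal hp00 ENNReal.coe_ne_top,
    eLpNorm_eq_lintegral_rpow_enorm_toReal hq00 ENNReal.coe_ne_top] at hS
  simp only [ENNReal.coe_toReal] at hS
  have hS' := ENNReal.rpow_le_rpow hS hp0.le
  rw [ENNReal.mul_rpow_of_nonneg _ _ hp0.le, ← ENNReal.rpow_mul, ← ENNReal.rpow_mul,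
    one_div_mul_cancel hp0.ne', ENNReal.rpow_one, one_div_mul_eq_div] at hS'
  calc (∫⁻ x in ball (0 : E) R, ‖u x‖ₑ ^ (q : ℝ) ∂μ) ^ ((p : ℝ) / q)
      ≤ (∫⁻ x, ‖v x‖ₑ ^ (q : ℝ) ∂μ) ^ ((p : ℝ) / q) := by
        refine ENNReal.rpow_le_rpow ?_ (by positivity)
        refine (setLIntegral_mono_ae' measurableSet_ball (ae_of_all _ fun x hx => ?_)).trans
          (setLIntegral_le_lintegral _ _)
        have : φ x = 1 := φ.one_of_mem_closedBall (ball_subset_closedBall hx)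
        simp [v, this]
    _ ≤ (C : ℝ≥0∞) ^ (p : ℝ) * ∫⁻ x, ‖fderiv ℝ v x‖ₑ ^ (p : ℝ) ∂μ := hS'
    _ ≤ (C : ℝ≥0∞) ^ (p : ℝ) * ((2 ^ ((p : ℝ) - 1) * (↑(max 1 M) : ℝ≥0∞) ^ (p : ℝ)) *
          ∫⁻ x in closedBall (0 : E) (2 * R),
            (‖fderiv ℝ u x‖ₑ ^ (p : ℝ) + ‖u x‖ₑ ^ (p : ℝ)) ∂μ) := by
        gcongr
        refine (lintegral_mono_ae hDv).trans ?_
        rw [lintegral_indicator measurableSet_closedBall, lintegral_const_mul]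
        exact ((measurable_fderiv ℝ u).enorm.pow_const _).add
          (hu.continuous.measurable.enorm.pow_const _)
    _ = _ := by
        rw [← mul_assoc]
        congr 1
        rw [ENNReal.coe_mul, ENNReal.coe_mul, ENNReal.coe_rpow_of_nonneg _ hp0.le,
          ENNReal.coe_rpow_of_nonneg _ (sub_nonneg.2 hp1), ENNReal.coe_rpow_of_nonneg _ hp0.le]
        simp

/-- A local Sobolev inequality on balls of fixed radius, uniform in the center. -/
theorem LipschitzWith.exists_lintegral_ball_rpow_le {p q : ℝ≥0} (hp : 1 ≤ p)
    (hpn : p < Module.finrank ℝ E) (hq : 0 < q)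
    (hpq : (p : ℝ)⁻¹ - (Module.finrank ℝ E : ℝ)⁻¹ ≤ (q : ℝ)⁻¹) {R : ℝ} (hR : 0 < R) :
    ∃ K : ℝ≥0, ∀ (u : E → ℝ) (L : ℝ≥0) (B : ℝ), LipschitzWith L u → (∀ x, ‖u x‖ ≤ B) → ∀ y : E,
      (∫⁻ x in ball y R, ‖u x‖ₑ ^ (q : ℝ) ∂μ) ^ ((p : ℝ) / q) ≤
        K * ∫⁻ x in closedBall y (2 * R),
          (‖fderiv ℝ u x‖ₑ ^ (p : ℝ) + ‖u x‖ₑ ^ (p : ℝ)) ∂μ := by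
  obtain ⟨K, hK⟩ := exists_lintegral_ball_zero_rpow_le μ hp hpn hq hpq hR
  refine ⟨K, fun u L B hu hB y => ?_⟩
  have h := hK (fun x => u (x + y)) L B
    (LipschitzWith.of_dist_le_mul fun a b => by simpa using hu.dist_le_mul (a + y) (b + y))
    (fun x => hB _)
  simp only [fderiv_comp_add_right] at h
  have htr (f : E → ℝ≥0∞) (s : Set E) :
      ∫⁻ x in (· + y) ⁻¹' s, f (x + y) ∂μ = ∫⁻ x in s, f x ∂μ :=
    (measurePreserving_add_right μ y).setLIntegral_comp_preimage_emb
      (measurableEmbedding_addRight y) f s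
  rw [← htr, ← htr _ (closedBall y (2 * R))]
  convert h using 4 <;> simp

/-- Balls of fixed radius centered at the points of a separated set have bounded overlap. -/
theorem Set.Pairwise.exists_tsum_indicator_closedBall_le {Γ : Set E} [Countable Γ] {ε : ℝ}
    (hε : 0 < ε) (hΓ : Γ.Pairwise fun y y' => ε ≤ dist y y') (r : ℝ) :
    ∃ N : ℝ≥0, ∀ x : E,
      ∑' y : Γ, (closedBall (y : E) r).indicator (1 : E → ℝ≥0∞) x ≤ N := by
  let μ : Measure E := volume
  set a := μ (ball 0 (ε / 2))
  have ha : a ≠ 0 := (measure_ball_pos μ 0 (half_pos hε)).ne'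
  have ha' : a ≠ ∞ := measure_ball_lt_top.ne
  refine ⟨(μ (ball 0 (r + ε)) / a).toNNReal, fun x => ?_⟩
  rw [ENNReal.coe_toNNReal (ENNReal.div_ne_top measure_ball_lt_top.ne ha),
    ENNReal.le_div_iff_mul_le (Or.inl ha) (Or.inl ha'), ← ENNReal.tsum_mul_right]
  calc ∑' y : Γ, (closedBall (y : E) r).indicator (1 : E → ℝ≥0∞) x * a
      ≤ ∑' y : Γ, μ (ball (y : E) (ε / 2) ∩ ball x (r + ε)) := by
        refine ENNReal.tsum_le_tsum fun y => ?_
        by_cases hx : x ∈ closedBall (y : E) r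
        · rw [Set.indicator_of_mem hx, Pi.one_apply, one_mul, Set.inter_eq_left.2]
          · exact (Measure.addHaar_ball_center μ (y : E) (ε / 2)).ge
          · refine ball_subset_ball' ?_
            rw [mem_closedBall, dist_comm] at hx
            linarith
        · simp [Set.indicator_of_notMem hx]
    _ = μ (⋃ y : Γ, ball (y : E) (ε / 2) ∩ ball x (r + ε)) :=
        (measure_iUnion (fun y y' h => (hΓ.pairwiseDisjoint_ball_half h).mono
          Set.inter_subset_left Set.inter_subset_left)
          fun y => measurableSet_ball.inter measurableSet_ball).symm
    _ ≤ μ (ball x (r + ε)) := measure_mono (Set.iUnion_subset fun y => Set.inter_subset_right)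
    _ = μ (ball 0 (r + ε)) := Measure.addHaar_ball_center μ x _

end LipschitzSobolev

theorem integrable_norm_fderiv_rpow_add_abs_rpow {m : ℕ} {p : ℝ} (hp : 0 < p)
    {u : EuclideanSpace ℝ (Fin m) → ℝ} {L : ℝ≥0} (hu : LipschitzWith L u)
    (hc : HasCompactSupport u) :
    Integrable fun x => ‖fderiv ℝ u x‖ ^ p + |u x| ^ p := by
  refine Integrable.add ?_ ?_
  · refine (integrableOn_iff_integrable_of_support_subset (s := tsupport u) fun x hx => ?_).1 ?_
    · exact support_fderiv_subset ℝ fun h => hx (by simp [h, hp.ne'])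
    · refine Measure.integrableOn_of_bounded (M := (L : ℝ) ^ p) hc.measure_lt_top.ne
        ((measurable_fderiv ℝ u).norm.pow_const p).aestronglyMeasurable (ae_of_all _ fun x => ?_)
      rw [Real.norm_of_nonneg (by positivity)]
      exact Real.rpow_le_rpow (norm_nonneg _) (norm_fderiv_le_of_lipschitz ℝ hu) hp.le
  · exact (hu.continuous.abs.rpow_const fun _ => Or.inr hp.le).integrable_of_hasCompactSupport
      (hc.comp_left (g := fun t => |t| ^ p) (by simp [hp.ne']))

theorem ofReal_abs_rpow (t : ℝ) {q : ℝ} (hq : 0 ≤ q) :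
    ENNReal.ofReal (|t| ^ q) = ‖t‖ₑ ^ q := by
  rw [← ENNReal.ofReal_rpow_of_nonneg (abs_nonneg t) hq, ← Real.norm_eq_abs, ofReal_norm]

/-- The key inequality of the spotlight lemma:
`∫|u|^q ≤ C · E_p(u) · (sup_{y∈Γ} ∫_{B(y,νε)}|u|^q)^{1−p/q}` for all compactly supported
Lipschitz `u`. -/
theorem stmt5 (m : ℕ) (hm : 2 ≤ m) (p q : ℝ) (hp : 1 < p) (hpm : p < m)
    (hq1 : p < q) (hq2 : q < m * p / (m - p))
    (ε : ℝ) (hε : 0 < ε) (ν : ℕ) (hν : 1 ≤ ν)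
    (Γ : Set (EuclideanSpace ℝ (Fin m))) (hΓ : IsDiscretization m ε ν Γ) :
    ∃ C : ℝ, 0 < C ∧ ∀ u : EuclideanSpace ℝ (Fin m) → ℝ,
      (∃ L : ℝ≥0, LipschitzWith L u) → HasCompactSupport u →
      ∫ x, |u x| ^ q ≤
        C * Ep m p u * (⨆ y ∈ Γ, ∫ x in ball y (ν * ε), |u x| ^ q) ^ (1 - p / q) := by
  have hp0 : 0 < p := zero_lt_one.trans hp
  have hq0 : 0 < q := hp0.trans hq1
  have hm0 : (0 : ℝ) < m := hp0.trans hpm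
  have hR : 0 < ν * ε := mul_pos (by exact_mod_cast hν) hε
  have hpq : p⁻¹ - (m : ℝ)⁻¹ ≤ q⁻¹ := by
    rw [lt_div_iff₀ (sub_pos.2 hpm)] at hq2
    rw [inv_sub_inv hp0.ne' hm0.ne', inv_eq_one_div q, div_le_div_iff₀ (by positivity) hq0]
    nlinarith
  have hθ1 : p / q ≤ 1 := (div_le_one hq0).2 hq1.le
  have hsep : Γ.Pairwise fun y y' => ε ≤ dist y y' := fun y hy y' hy' h => hΓ.1 y hy y' hy' h
  have : Countable Γ := hsep.pairwiseDisjoint_ball_half.countable_of_isOpen_disjoint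
    (fun _ => isOpen_ball) fun _ => nonempty_ball.2 (half_pos hε)
  obtain ⟨N, hN⟩ := hsep.exists_tsum_indicator_closedBall_le hε (2 * (ν * ε))
  lift p to ℝ≥0 using hp0.le
  lift q to ℝ≥0 using hq0.le
  have hfr : Module.finrank ℝ (EuclideanSpace ℝ (Fin m)) = m := by simp
  obtain ⟨K, hK⟩ := LipschitzWith.exists_lintegral_ball_rpow_le
    (volume : Measure (EuclideanSpace ℝ (Fin m))) (p := p) (q := q) (by exact_mod_cast hp.le)
    (by rw [hfr]; exact_mod_cast hpm) (by exact_mod_cast hq0) (by rwa [hfr]) hR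
  refine ⟨K * N + 1, by positivity, fun u ⟨L, hu⟩ hc => ?_⟩
  obtain ⟨B, hB⟩ := hc.exists_bound_of_continuous hu.continuous
  have hint : Integrable fun x => |u x| ^ (q : ℝ) :=
    (hu.continuous.abs.rpow_const fun _ => Or.inr hq0.le).integrable_of_hasCompactSupport
      (hc.comp_left (g := fun t => |t| ^ (q : ℝ)) (by simp [hq0.ne']))
  have hnn (x : EuclideanSpace ℝ (Fin m)) : 0 ≤ |u x| ^ (q : ℝ) := by positivity
  set S := ⨆ y ∈ Γ, ∫ x in ball y (ν * ε), |u x| ^ (q : ℝ) with hS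
  have hbound (y : EuclideanSpace ℝ (Fin m)) :
      ⨆ _ : y ∈ Γ, ∫ x in ball y (ν * ε), |u x| ^ (q : ℝ) ≤ ∫ x, |u x| ^ (q : ℝ) :=
    Real.iSup_le (fun _ => setIntegral_le_integral hint (ae_of_all _ hnn))
      (integral_nonneg hnn)
  have hSle (y : EuclideanSpace ℝ (Fin m)) (hy : y ∈ Γ) :
      ∫ x in ball y (ν * ε), |u x| ^ (q : ℝ) ≤ S := by
    refine le_trans (le_of_eq ?_) (le_ciSup ⟨_, Set.forall_mem_range.2 hbound⟩ y)
    rw [ciSup_pos hy]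
  have hS0 : 0 ≤ S :=
    Real.iSup_nonneg fun y => Real.iSup_nonneg fun _ => integral_nonneg fun x => hnn x
  have hE0 : 0 ≤ Ep m p u := integral_nonneg fun x => by positivity
  have hf : Measurable fun x => ‖fderiv ℝ u x‖ₑ ^ (p : ℝ) + ‖u x‖ₑ ^ (p : ℝ) :=
    ((measurable_fderiv ℝ u).enorm.pow_const _).add (hu.continuous.measurable.enorm.pow_const _)
  have hEp : ENNReal.ofReal (Ep m p u) =
      ∫⁻ x, (‖fderiv ℝ u x‖ₑ ^ (p : ℝ) + ‖u x‖ₑ ^ (p : ℝ)) := by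
    rw [Ep, ofReal_integral_eq_lintegral_ofReal
      (integrable_norm_fderiv_rpow_add_abs_rpow hp0 hu hc) (ae_of_all _ fun x => by positivity)]
    refine lintegral_congr fun x => ?_
    rw [ENNReal.ofReal_add (by positivity) (by positivity), ofReal_abs_rpow _ hp0.le,
      ← ENNReal.ofReal_rpow_of_nonneg (norm_nonneg _) hp0.le, ofReal_norm]
  have hlint (μ : Measure (EuclideanSpace ℝ (Fin m))) (h : Integrable (fun x => |u x| ^ (q : ℝ)) μ) :
      ENNReal.ofReal (∫ x, |u x| ^ (q : ℝ) ∂μ) = ∫⁻ x, ‖u x‖ₑ ^ (q : ℝ) ∂μ := by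
    rw [ofReal_integral_eq_lintegral_ofReal h (ae_of_all _ hnn)]
    simp_rw [ofReal_abs_rpow _ hq0.le]
  have key := lintegral_le_of_ball_cover (volume : Measure (EuclideanSpace ℝ (Fin m)))
    (A := ENNReal.ofReal S) hΓ.2 hN hf (by positivity) hθ1
    (fun y hy => by
      rw [← hlint _ hint.integrableOn]
      exact ENNReal.ofReal_le_ofReal (hSle y hy))
    (fun y _ => hK u L B hu hB y)
  rw [← hEp, ← hlint _ hint, ENNReal.ofReal_rpow_of_nonneg hS0 (sub_nonneg.2 hθ1),
    ← ENNReal.ofReal_coe_nnreal, ← ENNReal.ofReal_coe_nnreal (p := N),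
    ← ENNReal.ofReal_mul N.coe_nonneg, ← ENNReal.ofReal_mul K.coe_nonneg,
    ← ENNReal.ofReal_mul (by positivity), ENNReal.ofReal_le_ofReal_iff (by positivity)] at key
  refine key.trans ?_
  rw [← mul_assoc (K : ℝ), mul_comm]
  gcongr
  linarith
end

section
/- (Chain-of-balls property of maximal separated subsets of connected sets.) Let X be a metric space, r > 0, let C ⊆ X be a connected subset, and let S ⊆ C be a finite subset with at least two elements such that d(s,s′) ≥ 2r for all distinct s,s′ ∈ S, and such that S is maximal with respect to inclusion among subsets of C whose distinct points are at distance ≥ 2r from each other. Then for every x ∈ S there exists y ∈ S with y ≠ x and d(x,y) ≤ 4r. -/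
theorem exists_dist_lt_of_maximal_separated {X : Type*} [MetricSpace X] {δ : ℝ} (hδ : 0 < δ)
    {C S : Set X} (hSC : S ⊆ C)
    (hsep : ∀ s ∈ S, ∀ s' ∈ S, s ≠ s' → δ ≤ dist s s')
    (hmax : ∀ T : Set X, T ⊆ C → S ⊆ T →
      (∀ s ∈ T, ∀ s' ∈ T, s ≠ s' → δ ≤ dist s s') → T = S)
    {c : X} (hc : c ∈ C) : ∃ s ∈ S, dist c s < δ := by
  by_contra! h
  have hins : insert c S = S := by
    refine hmax _ (Set.insert_subset hc hSC) (Set.subset_insert c S) ?_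
    rintro s (rfl | hs) s' (rfl | hs') hne
    · exact absurd rfl hne
    · exact h s' hs'
    · rw [dist_comm]
      exact h s hs
    · exact hsep s hs s' hs' hne
  have hcS : c ∈ S := hins ▸ Set.mem_insert c S
  have := h c hcS
  rw [dist_self] at this
  linarith

/-- (Chain-of-balls property.) If `S` is a finite `2r`-separated subset of a
connected set `C`, with at least two elements, and `S` is maximal with respect to inclusion among
`2r`-separated subsets of `C`, then every point of `S` has another point of `S` within
distance `4r`. -/
theorem stmt13 {X : Type*} [MetricSpace X] (r : ℝ) (hr : 0 < r)
    (C : Set X) (hC : IsConnected C)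
    (S : Set X) (hSC : S ⊆ C) (hSfin : S.Finite) (hScard : 2 ≤ S.ncard)
    (hsep : ∀ s ∈ S, ∀ s' ∈ S, s ≠ s' → 2 * r ≤ dist s s')
    (hmax : ∀ T : Set X, T ⊆ C → S ⊆ T →
      (∀ s ∈ T, ∀ s' ∈ T, s ≠ s' → 2 * r ≤ dist s s') → T = S) :
    ∀ x ∈ S, ∃ y ∈ S, y ≠ x ∧ dist x y ≤ 4 * r := by
  intro x hx
  obtain ⟨w, hw, hwx⟩ := Set.exists_ne_of_one_lt_ncard (by lia : 1 < S.ncard) x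
  have hr2 : 0 < 2 * r := by positivity
  have hcover : C ⊆ Metric.ball x (2 * r) ∪ ⋃ y ∈ S \ {x}, Metric.ball y (2 * r) := by
    intro c hc
    obtain ⟨s, hs, hcs⟩ := exists_dist_lt_of_maximal_separated hr2 hSC hsep hmax hc
    by_cases hsx : s = x
    · exact Or.inl (hsx ▸ hcs)
    · exact Or.inr (Set.mem_biUnion (⟨hs, hsx⟩ : s ∈ S \ {x}) hcs)
  obtain ⟨z, -, hzx, hz⟩ := hC.isPreconnected _ _ Metric.isOpen_ball
    (isOpen_biUnion fun _ _ => Metric.isOpen_ball) hcover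
    ⟨x, hSC hx, Metric.mem_ball_self hr2⟩
    ⟨w, hSC hw, Set.mem_biUnion (⟨hw, hwx⟩ : w ∈ S \ {x}) (Metric.mem_ball_self hr2)⟩
  obtain ⟨y, ⟨hy, hyx⟩, hzy⟩ := Set.mem_iUnion₂.1 hz
  refine ⟨y, hy, hyx, ?_⟩
  rw [Metric.mem_ball] at hzx hzy
  linarith [dist_triangle_left x y z]
end

section
/- (Diameter bound for connected sets from maximal separated subsets.) Let X be a metric space, r > 0, let C ⊆ X be a nonempty connected subset, and let S ⊆ C be a finite nonempty subset such that d(s,s′) ≥ 2r for all distinct s,s′ ∈ S, and such that S is maximal with respect to inclusion among subsets of C whose distinct points are at distance ≥ 2r from each other. Then diam C ≤ 4r·#S. -/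
open MeasureTheory in
/-- A preconnected set covered by `n` balls of radius `ρ` has diameter at most `2 * ρ * n`. -/
theorem IsPreconnected.ediam_le_card_mul_of_subset_iUnion_ball {X : Type*} [PseudoMetricSpace X]
    {C : Set X} (hC : IsPreconnected C) {t : Finset X} {ρ : ℝ}
    (hcover : C ⊆ ⋃ s ∈ t, Metric.ball s ρ) :
    Metric.ediam C ≤ t.card * ENNReal.ofReal (2 * ρ) := by
  refine Metric.ediam_le fun y hy z hz => ?_
  have hsub : Set.Icc 0 (dist y z) ⊆ ⋃ s ∈ t, Metric.ball (dist y s) ρ := by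
    intro a ha
    have himage : Set.Icc (dist y y) (dist y z) ⊆ (fun x => dist y x) '' C :=
      hC.intermediate_value hy hz (by fun_prop)
    obtain ⟨x, hx, rfl⟩ := himage (by simpa using ha)
    obtain ⟨s, hs, hxs⟩ := Set.mem_iUnion₂.1 (hcover hx)
    refine Set.mem_iUnion₂.2 ⟨s, hs, ?_⟩
    rw [Metric.mem_ball] at hxs ⊢
    exact (dist_dist_dist_le_right y x s).trans_lt hxs
  calc edist y z = volume (Set.Icc 0 (dist y z)) := by simp [edist_dist]
    _ ≤ volume (⋃ s ∈ t, Metric.ball (dist y s) ρ) := measure_mono hsub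
    _ ≤ ∑ s ∈ t, volume (Metric.ball (dist y s) ρ) := measure_biUnion_finset_le _ _
    _ = t.card * ENNReal.ofReal (2 * ρ) := by simp [Real.volume_ball]

/-- The balls of radius `ε` around a maximal `ε`-separated subset of `C` cover `C`. -/
theorem subset_iUnion_ball_of_maximal_separated {X : Type*} [PseudoMetricSpace X] {ε : ℝ}
    (hε : 0 < ε) {C S : Set X} (hSC : S ⊆ C)
    (hsep : ∀ s ∈ S, ∀ s' ∈ S, s ≠ s' → ε ≤ dist s s')
    (hmax : ∀ T : Set X, T ⊆ C → S ⊆ T →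
      (∀ s ∈ T, ∀ s' ∈ T, s ≠ s' → ε ≤ dist s s') → T = S) :
    C ⊆ ⋃ s ∈ S, Metric.ball s ε := by
  intro x hx
  by_contra hnot
  have hfar : ∀ s ∈ S, ε ≤ dist x s := by simpa using hnot
  have hxS : x ∈ S := by
    rw [← hmax (insert x S) (Set.insert_subset hx hSC) (Set.subset_insert x S) ?_]
    · exact Set.mem_insert x S
    · rintro s (rfl | hs) s' (rfl | hs') hne
      · exact absurd rfl hne
      · exact hfar s' hs'
      · exact dist_comm s s' ▸ hfar s hs
      · exact hsep s hs s' hs' hne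
  have := hfar x hxS
  rw [dist_self] at this
  exact this.not_gt hε

/-- (Diameter bound from maximal separated subsets.) If `S` is a finite
nonempty `2r`-separated subset of a nonempty connected set `C`, maximal with respect to inclusion
among `2r`-separated subsets of `C`, then `diam C ≤ 4r·#S`. -/
theorem stmt14 {X : Type*} [MetricSpace X] (r : ℝ) (hr : 0 < r)
    (C : Set X) (hC : IsConnected C)
    (S : Set X) (hSC : S ⊆ C) (hSfin : S.Finite) (hSne : S.Nonempty)
    (hsep : ∀ s ∈ S, ∀ s' ∈ S, s ≠ s' → 2 * r ≤ dist s s')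
    (hmax : ∀ T : Set X, T ⊆ C → S ⊆ T →
      (∀ s ∈ T, ∀ s' ∈ T, s ≠ s' → 2 * r ≤ dist s s') → T = S) :
    EMetric.diam C ≤ ENNReal.ofReal (4 * r * S.ncard) := by
  have hcover : C ⊆ ⋃ s ∈ hSfin.toFinset, Metric.ball s (2 * r) := by
    simpa using subset_iUnion_ball_of_maximal_separated (by positivity) hSC hsep hmax
  refine (hC.isPreconnected.ediam_le_card_mul_of_subset_iUnion_ball hcover).trans_eq ?_
  rw [← Set.ncard_eq_toFinset_card S hSfin, ← ENNReal.ofReal_natCast,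
    ← ENNReal.ofReal_mul (Nat.cast_nonneg _)]
  congr 1
  ring
end

section
/- (Far-ball estimate, Euclidean case.) Let m > n ≥ 1 and let φ : ℝ^m → ℝ^n be a Lipschitz map satisfying the standing Jacobian assumptions, which is level-coercive, has connected level sets, and has uniformly thick levels with thickness radius r > 0. Fix x₀ ∈ ℝ^m and 1 ≤ q < ∞. For R > 0 define σ_R as the supremum, over all x ∈ ℝ^m with ‖x−x₀‖ ≥ R and over all measurable h : ℝ^n → [0,∞) with 0 < ∫_{ℝ^m}(h∘φ)^q dx < ∞, of the ratio (∫_{B(x,r)} (h∘φ)^q dx) / (∫_{ℝ^m} (h∘φ)^q dx). Then σ_R → 0 as R → ∞. -/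
open MeasureTheory Metric Filter
open scoped NNReal ENNReal

/-- The absolute value of the normal Jacobian of `φ` at `x`:
`J_φ(x) = √(det(Dφ(x)∘Dφ(x)*))`. -/
noncomputable def Jphi (m n : ℕ) (φ : EuclideanSpace ℝ (Fin m) → EuclideanSpace ℝ (Fin n))
    (x : EuclideanSpace ℝ (Fin m)) : ℝ :=
  Real.sqrt (LinearMap.det
    (((fderiv ℝ φ x) ∘L (ContinuousLinearMap.adjoint (fderiv ℝ φ x))).toLinearMap))

/-- `Ψ(z) = ∫_{φ⁻¹(z)} J_φ⁻¹ dH_{m−n}`. -/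
noncomputable def Psi (m n : ℕ) (φ : EuclideanSpace ℝ (Fin m) → EuclideanSpace ℝ (Fin n))
    (z : EuclideanSpace ℝ (Fin n)) : ℝ≥0∞ :=
  ∫⁻ x in φ ⁻¹' {z}, ENNReal.ofReal ((Jphi m n φ x)⁻¹) ∂(μH[(m : ℝ) - n])

/-- `∫_{φ⁻¹(z) ∩ B(y,r)} J_φ⁻¹ dH_{m−n}`. -/
noncomputable def levelBallMass (m n : ℕ)
    (φ : EuclideanSpace ℝ (Fin m) → EuclideanSpace ℝ (Fin n))
    (r : ℝ) (z : EuclideanSpace ℝ (Fin n)) (y : EuclideanSpace ℝ (Fin m)) : ℝ≥0∞ :=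
  ∫⁻ x in φ ⁻¹' {z} ∩ ball y r, ENNReal.ofReal ((Jphi m n φ x)⁻¹) ∂(μH[(m : ℝ) - n])

/-- Standing Jacobian assumptions: `J_φ ≠ 0` a.e. on `ℝ^m` and `Ψ(z) < ∞` for a.e. `z ∈ ℝ^n`. -/
def StandingJacobian (m n : ℕ)
    (φ : EuclideanSpace ℝ (Fin m) → EuclideanSpace ℝ (Fin n)) : Prop :=
  (∀ᵐ x : EuclideanSpace ℝ (Fin m) ∂volume, Jphi m n φ x ≠ 0) ∧
  (∀ᵐ z : EuclideanSpace ℝ (Fin n) ∂volume, Psi m n φ z < ⊤)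

/-- `φ` is level-coercive: all level sets are compact and the set of points whose level set has
diameter at most `t` is bounded, for every `t > 0`. -/
def LevelCoercive (m n : ℕ)
    (φ : EuclideanSpace ℝ (Fin m) → EuclideanSpace ℝ (Fin n)) : Prop :=
  (∀ z, IsCompact (φ ⁻¹' {z})) ∧
  ∀ t : ℝ, 0 < t → Bornology.IsBounded
    { x : EuclideanSpace ℝ (Fin m) | EMetric.diam (φ ⁻¹' {φ x}) ≤ ENNReal.ofReal t }

/-- `φ` has uniformly thick levels with thickness radius `r`. -/
def UniformlyThick (m n : ℕ)
    (φ : EuclideanSpace ℝ (Fin m) → EuclideanSpace ℝ (Fin n)) (r : ℝ) : Prop :=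
  ∃ ε₀ : ℝ, 0 < ε₀ ∧ ∃ A : Set (EuclideanSpace ℝ (Fin m)), IsOpen A ∧
    Bornology.IsBounded A ∧
    ∀ᵐ z : EuclideanSpace ℝ (Fin n) ∂volume, z ∈ Set.range φ →
      ENNReal.ofReal ε₀ * (⨆ y ∈ φ ⁻¹' {z} \ A, levelBallMass m n φ r z y) ≤
        ⨅ y ∈ φ ⁻¹' {z} \ A, levelBallMass m n φ r z y

theorem LinearMap.det_adjoint_euclidean {n : ℕ}
    (B : EuclideanSpace ℝ (Fin n) →ₗ[ℝ] EuclideanSpace ℝ (Fin n)) :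
    LinearMap.det (LinearMap.adjoint B) = LinearMap.det B := by
  let b := EuclideanSpace.basisFun (Fin n) ℝ
  rw [← LinearMap.det_toMatrix b.toBasis, ← LinearMap.det_toMatrix b.toBasis,
    LinearMap.toMatrix_adjoint, Matrix.det_conjTranspose]
  simp

theorem exists_orthogonal_coordinates {m n : ℕ}
    (T : EuclideanSpace ℝ (Fin m) →L[ℝ] EuclideanSpace ℝ (Fin n))
    (hT : LinearMap.det ((T ∘L (ContinuousLinearMap.adjoint T)).toLinearMap) ≠ 0) :
    ∃ (e : (EuclideanSpace ℝ (Fin n) × EuclideanSpace ℝ (Fin (m - n))) ≃L[ℝ]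
        EuclideanSpace ℝ (Fin m)) (B : EuclideanSpace ℝ (Fin n) →L[ℝ] EuclideanSpace ℝ (Fin n)),
      MeasurePreserving e ∧ (∀ p, ‖e p‖ ≤ ‖p.1‖ + ‖p.2‖) ∧ (∀ p, ‖p.2‖ ≤ ‖e p‖) ∧
      (∀ p, T (e p) = B p.1) ∧
      LinearMap.det ((T ∘L (ContinuousLinearMap.adjoint T)).toLinearMap) = B.det ^ 2 := by
  have hsurj : Function.Surjective T := by
    have h1 := (LinearMap.equivOfDetNeZero _ hT).surjective
    intro y
    obtain ⟨x, hx⟩ := h1 y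
    exact ⟨_, hx⟩
  set H : Submodule ℝ (EuclideanSpace ℝ (Fin m)) := (LinearMap.ker T.toLinearMap)ᗮ with hH
  have hHH : Hᗮ = LinearMap.ker T.toLinearMap := Submodule.orthogonal_orthogonal _
  have hk : Module.finrank ℝ (LinearMap.ker T.toLinearMap) + n = m := by
    have := LinearMap.finrank_range_add_finrank_ker T.toLinearMap
    rw [LinearMap.range_eq_top.2 hsurj, finrank_top] at this
    simp at this
    omega
  have hd1 : Module.finrank ℝ H = n := by
    have := Submodule.finrank_add_finrank_orthogonal (LinearMap.ker T.toLinearMap)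
    simp only [finrank_euclideanSpace, Fintype.card_fin] at this
    change _ + Module.finrank ℝ H = m at this
    omega
  have hd2 : Module.finrank ℝ Hᗮ = m - n := by
    rw [hHH]; omega
  let i1 := ((stdOrthonormalBasis ℝ H).reindex (finCongr hd1)).repr
  let i2 := ((stdOrthonormalBasis ℝ Hᗮ).reindex (finCongr hd2)).repr
  let e1 : (EuclideanSpace ℝ (Fin n) × EuclideanSpace ℝ (Fin (m - n))) ≃L[ℝ] (H × Hᗮ) :=
    i1.symm.toContinuousLinearEquiv.prodCongr i2.symm.toContinuousLinearEquiv
  let e2 : (H × Hᗮ) ≃L[ℝ] WithLp 2 (H × Hᗮ) := (WithLp.prodContinuousLinearEquiv 2 ℝ H Hᗮ).symm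
  let e3 : WithLp 2 (H × Hᗮ) ≃L[ℝ] EuclideanSpace ℝ (Fin m) :=
    H.orthogonalDecomposition.symm.toContinuousLinearEquiv
  have hev : ∀ p, (e1.trans (e2.trans e3)) p = (i1.symm p.1 : EuclideanSpace ℝ (Fin m)) +
      (i2.symm p.2 : EuclideanSpace ℝ (Fin m)) := by
    intro p
    rfl
  have hsq : ∀ p, ‖(e1.trans (e2.trans e3)) p‖ ^ 2 = ‖p.1‖ ^ 2 + ‖p.2‖ ^ 2 := by
    intro p
    have : ‖(e1.trans (e2.trans e3)) p‖ = ‖e2 (e1 p)‖ :=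
      H.orthogonalDecomposition.symm.norm_map _
    rw [this, WithLp.prod_norm_sq_eq_of_L2]
    simp [e1, e2]
  let j : EuclideanSpace ℝ (Fin n) →L[ℝ] EuclideanSpace ℝ (Fin m) :=
    H.subtypeL ∘L (i1.symm.toContinuousLinearEquiv : EuclideanSpace ℝ (Fin n) →L[ℝ] H)
  refine ⟨e1.trans (e2.trans e3), T ∘L j, ?_, ?_, ?_, ?_, ?_⟩
  · refine (H.orthogonalDecomposition.symm.measurePreserving.comp
      (WithLp.volume_preserving_toLp H Hᗮ)).comp
      (i1.symm.measurePreserving.prod i2.symm.measurePreserving)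
  · intro p
    have := hsq p
    nlinarith [norm_nonneg p.1, norm_nonneg p.2, norm_nonneg ((e1.trans (e2.trans e3)) p),
      mul_nonneg (norm_nonneg p.1) (norm_nonneg p.2)]
  · intro p
    have := hsq p
    nlinarith [norm_nonneg p.1, norm_nonneg p.2, norm_nonneg ((e1.trans (e2.trans e3)) p)]
  · intro p
    have h2 : T (i2.symm p.2 : EuclideanSpace ℝ (Fin m)) = 0 := by
      have : (i2.symm p.2 : EuclideanSpace ℝ (Fin m)) ∈ LinearMap.ker T.toLinearMap :=
        hHH.le (i2.symm p.2).2
      exact this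
    rw [hev, map_add, h2, add_zero]
    rfl
  · have hjj : ∀ x, T (j (ContinuousLinearMap.adjoint j x)) = T x := by
      intro x
      have hx : x - j (ContinuousLinearMap.adjoint j x) ∈ LinearMap.ker T.toLinearMap := by
        refine hHH.le ?_
        rw [Submodule.mem_orthogonal]
        intro u hu
        obtain ⟨v, hv⟩ := i1.symm.surjective ⟨u, hu⟩
        have hjv : j v = u := congrArg Subtype.val hv
        have hjin : ∀ a b, inner ℝ (j a) (j b) = inner ℝ a b := fun a b =>
          i1.symm.inner_map_map a b
        rw [← hjv, inner_sub_right, hjin, ContinuousLinearMap.adjoint_inner_right, sub_self]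
      have hx' : T (x - j (ContinuousLinearMap.adjoint j x)) = 0 := hx
      rw [map_sub, sub_eq_zero] at hx'
      exact hx'.symm
    have : (T ∘L (ContinuousLinearMap.adjoint T)) =
        (T ∘L j) ∘L ContinuousLinearMap.adjoint (T ∘L j) := by
      rw [ContinuousLinearMap.adjoint_comp]
      ext1 x
      simp [hjj]
    rw [this]
    have h2 := LinearMap.det_adjoint_euclidean (T ∘L j).toLinearMap
    change LinearMap.det ((T ∘L j).toLinearMap ∘ₗ (LinearMap.adjoint (T ∘L j).toLinearMap)) = _
    rw [LinearMap.det_comp, h2, sq]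

/-- Hausdorff measure is at most `K ^ d` times that of an image under a map expanding distances on
the set by at least `K⁻¹`. -/
theorem hausdorffMeasure_le_of_dist_le {X Y : Type*} [MetricSpace X] [MetricSpace Y]
    [MeasurableSpace X] [BorelSpace X] [MeasurableSpace Y] [BorelSpace Y]
    {f : X → Y} {s : Set X} {K : ℝ≥0} {d : ℝ} (hd : 0 ≤ d)
    (hf : ∀ x ∈ s, ∀ y ∈ s, dist x y ≤ K * dist (f x) (f y)) :
    μH[d] s ≤ (K : ℝ≥0∞) ^ d * μH[d] (f '' s) := by
  rcases s.eq_empty_or_nonempty with rfl | ⟨x₀, -⟩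
  · simp
  have : Nonempty X := ⟨x₀⟩
  have hinj : Set.InjOn f s := by
    intro x hx y hy hxy
    have := hf x hx y hy
    rw [hxy, dist_self, mul_zero] at this
    exact dist_le_zero.1 this
  have hinv := hinj.leftInvOn_invFunOn
  have himg : Function.invFunOn f s '' (f '' s) = s := hinv.image_image
  have hlip : LipschitzOnWith K (Function.invFunOn f s) (f '' s) := by
    refine LipschitzOnWith.of_dist_le_mul ?_
    rintro _ ⟨x, hx, rfl⟩ _ ⟨y, hy, rfl⟩
    rw [hinv hx, hinv hy]
    exact hf x hx y hy
  have := hlip.hausdorffMeasure_image_le hd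
  rwa [himg] at this

theorem exists_hausdorffMeasure_eq_smul_volume (d : ℕ) :
    ∃ c : ℝ≥0, c ≠ 0 ∧
      (μH[(d : ℝ)] : Measure (EuclideanSpace ℝ (Fin d))) = c • volume := by
  have hh : Measure.IsAddHaarMeasure (μH[(d : ℝ)] : Measure (EuclideanSpace ℝ (Fin d))) := by
    simpa using isAddHaarMeasure_hausdorffMeasure (E := EuclideanSpace ℝ (Fin d))
  refine ⟨_, (Measure.addHaarScalarFactor_pos_of_isAddHaarMeasure _ _).ne',
    Measure.isAddLeftInvariant_eq_smul _ _⟩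

/-- Two-sided coarea estimate on a set where the map is close to a surjective linear map. -/
theorem exists_slice_measure_of_approximatesLinearOn {m n : ℕ} (hnm : n ≤ m) {c : ℝ≥0}
    (hc0 : c ≠ 0)
    (hc : (μH[((m - n : ℕ) : ℝ)] : Measure (EuclideanSpace ℝ (Fin (m - n)))) = c • volume)
    (T : EuclideanSpace ℝ (Fin m) →L[ℝ] EuclideanSpace ℝ (Fin n))
    (hT : LinearMap.det ((T ∘L (ContinuousLinearMap.adjoint T)).toLinearMap) ≠ 0)
    {J : ℝ≥0}
    (hJ : (J : ℝ) =
      Real.sqrt (LinearMap.det ((T ∘L (ContinuousLinearMap.adjoint T)).toLinearMap))) :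
    ∃ δ : ℝ≥0, 0 < δ ∧ ∀ (φ : EuclideanSpace ℝ (Fin m) → EuclideanSpace ℝ (Fin n))
      (D : Set (EuclideanSpace ℝ (Fin m))), Continuous φ → MeasurableSet D →
      ApproximatesLinearOn φ T D δ →
      ∃ S : EuclideanSpace ℝ (Fin n) → ℝ≥0∞, Measurable S ∧
        (∀ z, μH[(m : ℝ) - n] (φ ⁻¹' {z} ∩ D) ≤ (2 ^ (m - n) * c : ℝ≥0) * S z) ∧
        (∀ z, S z ≤ (c⁻¹ : ℝ≥0) * μH[(m : ℝ) - n] (φ ⁻¹' {z} ∩ D)) ∧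
        ∀ E, MeasurableSet E →
          (J / 2 : ℝ≥0) * volume (D ∩ φ ⁻¹' E) ≤ ∫⁻ z in E, S z ∧
          ∫⁻ z in E, S z ≤ (2 * J : ℝ≥0) * volume (D ∩ φ ⁻¹' E) := by
  obtain ⟨e, B, hmp, hle, hge, hTe, hdet⟩ := exists_orthogonal_coordinates T hT
  have hB : B.det ≠ 0 := by
    intro h
    rw [hdet, h] at hT
    simp at hT
  rw [hdet, Real.sqrt_sq_eq_abs] at hJ
  have hcast : (m : ℝ) - n = ((m - n : ℕ) : ℝ) := by push_cast [hnm]; rfl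
  rw [hcast]
  have hJpos : 0 < J := by
    rw [← NNReal.coe_pos, hJ]; exact abs_pos.2 hB
  let L : (EuclideanSpace ℝ (Fin n) × EuclideanSpace ℝ (Fin (m - n))) →L[ℝ]
      (EuclideanSpace ℝ (Fin n) × EuclideanSpace ℝ (Fin (m - n))) :=
    B.prodMap (ContinuousLinearMap.id ℝ _)
  have hL : ENNReal.ofReal |L.det| = J := by
    have : L.det = B.det := by
      change LinearMap.det (LinearMap.prodMap B.toLinearMap
        (LinearMap.id : EuclideanSpace ℝ (Fin (m - n)) →ₗ[ℝ] _)) = _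
      rw [LinearMap.det_prodMap, LinearMap.det_id, mul_one]
    rw [this, ← hJ, ENNReal.ofReal_coe_nnreal]
  have hup : ENNReal.ofReal |L.det| < (2 * J : ℝ≥0) := by
    rw [hL, ENNReal.coe_lt_coe, two_mul]
    exact lt_add_of_pos_left J hJpos
  have hlow : ((J / 2 : ℝ≥0) : ℝ≥0∞) < ENNReal.ofReal |L.det| := by
    rw [hL, ENNReal.coe_lt_coe]
    exact NNReal.half_lt_self hJpos.ne'
  have : (volume : Measure (EuclideanSpace ℝ (Fin n) ×
      EuclideanSpace ℝ (Fin (m - n)))).IsAddHaarMeasure :=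
    Measure.prod.instIsAddHaarMeasure volume volume
  obtain ⟨δ', ⟨h1, h2⟩, hδ'⟩ := (((addHaar_image_le_mul_of_det_lt volume L hup).and
    (mul_le_addHaar_image_of_lt_det volume L hlow)).and self_mem_nhdsWithin).exists
  replace hδ' : 0 < δ' := hδ'
  obtain ⟨b, hb0, hb⟩ : ∃ b : ℝ≥0, 0 < b ∧ ∀ u, ‖u‖ ≤ b * ‖B u‖ := by
    let B' := B.toContinuousLinearEquivOfDetNeZero hB
    refine ⟨‖(B'.symm : EuclideanSpace ℝ (Fin n) →L[ℝ] EuclideanSpace ℝ (Fin n))‖₊ + 1,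
      by positivity, fun u => ?_⟩
    have h3 := (B'.symm : EuclideanSpace ℝ (Fin n) →L[ℝ] EuclideanSpace ℝ (Fin n)).le_opNorm (B u)
    have h4 : B'.symm (B u) = u := B'.symm_apply_apply u
    simp only [ContinuousLinearEquiv.coe_coe, h4] at h3
    refine h3.trans ?_
    push_cast
    gcongr
    linarith
  refine ⟨min (δ' / 2) (1 / (2 * b)), by positivity, fun φ D hφ hD happ => ?_⟩
  have hδ1 : ((min (δ' / 2) (1 / (2 * b)) : ℝ≥0) : ℝ) ≤ δ' / 2 := by
    exact_mod_cast min_le_left (δ' / 2) (1 / (2 * b))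
  have hδ2 : (b : ℝ) * ((min (δ' / 2) (1 / (2 * b)) : ℝ≥0) : ℝ) ≤ 1 / 2 := by
    have : ((min (δ' / 2) (1 / (2 * b)) : ℝ≥0) : ℝ) ≤ 1 / (2 * b) := by
      exact_mod_cast min_le_right (δ' / 2) (1 / (2 * b))
    calc (b : ℝ) * _ ≤ b * (1 / (2 * b)) := by gcongr
      _ = 1 / 2 := by field_simp
  generalize min (δ' / 2) (1 / (2 * b)) = δ at happ hδ1 hδ2
  let ψ : (EuclideanSpace ℝ (Fin n) × EuclideanSpace ℝ (Fin (m - n))) →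
      (EuclideanSpace ℝ (Fin n) × EuclideanSpace ℝ (Fin (m - n))) := fun p => (φ (e p), p.2)
  have hψc : Continuous ψ := by fun_prop
  have hψ : ApproximatesLinearOn ψ L (e ⁻¹' D) δ' := by
    intro x hx y hy
    have h3 := happ (e x) hx (e y) hy
    have h4 : ψ x - ψ y - L (x - y) = (φ (e x) - φ (e y) - T (e x - e y), 0) := by
      rw [← map_sub e, hTe]
      ext1 <;> simp [ψ, L]
    rw [h4, Prod.norm_mk, norm_zero, max_eq_left (norm_nonneg _)]
    refine h3.trans ?_
    rw [← map_sub e]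
    have h5 := hle (x - y)
    have h6 := norm_fst_le (x - y)
    have h7 := norm_snd_le (x - y)
    calc (δ : ℝ) * ‖e (x - y)‖ ≤ (δ' / 2) * (2 * ‖x - y‖) := by
          gcongr
          linarith
      _ = _ := by ring
  have hkey : ∀ x ∈ D, ∀ y ∈ D, φ x = φ y →
      ‖x - y‖ ≤ 2 * ‖(e.symm x).2 - (e.symm y).2‖ := by
    intro x hx y hy hxy
    have h3 := happ x hx y hy
    have h4 : T (x - y) = B (e.symm (x - y)).1 := by rw [← hTe, e.apply_symm_apply]
    have h5 := hle (e.symm (x - y))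
    have h6 := hb (e.symm (x - y)).1
    rw [e.apply_symm_apply] at h5
    rw [hxy, sub_self, zero_sub, norm_neg, h4] at h3
    have h7 : ‖(e.symm (x - y)).1‖ ≤ 1 / 2 * ‖x - y‖ := by
      calc _ ≤ _ := h6
        _ ≤ b * (δ * ‖x - y‖) := by gcongr
        _ = (b * δ) * ‖x - y‖ := by ring
        _ ≤ _ := by gcongr
    rw [map_sub, Prod.snd_sub] at h5
    rw [map_sub] at h7
    linarith
  have hinj : Set.InjOn ψ (e ⁻¹' D) := by
    intro x hx y hy hxy
    have h3 := hkey (e x) hx (e y) hy (congrArg Prod.fst hxy)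
    have h4 : x.2 = y.2 := (congrArg Prod.snd hxy : (ψ x).2 = (ψ y).2)
    rw [e.symm_apply_apply, e.symm_apply_apply, h4, sub_self, norm_zero, mul_zero] at h3
    exact e.injective (sub_eq_zero.1 (norm_le_zero_iff.1 h3))
  have hD' : MeasurableSet (e ⁻¹' D) := e.continuous.measurable hD
  have himg : MeasurableSet (ψ '' (e ⁻¹' D)) :=
    hD'.image_of_continuousOn_injOn hψc.continuousOn hinj
  have hslice : ∀ z, Prod.mk z ⁻¹' (ψ '' (e ⁻¹' D)) =
      (fun x => (e.symm x).2) '' (φ ⁻¹' {z} ∩ D) := by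
    intro z
    ext w
    constructor
    · rintro ⟨p, hp, hpw⟩
      exact ⟨e p, ⟨congrArg Prod.fst hpw, hp⟩, by
        simpa using congrArg Prod.snd hpw⟩
    · rintro ⟨x, ⟨hx1, hx2⟩, rfl⟩
      refine ⟨e.symm x, by simpa using hx2, ?_⟩
      simp only [Set.mem_preimage, Set.mem_singleton_iff] at hx1
      simp [ψ, hx1]
  have hvol : ∀ A : Set (EuclideanSpace ℝ (Fin (m - n))),
      μH[((m - n : ℕ) : ℝ)] A = c * volume A := by
    intro A; rw [hc]; rfl
  refine ⟨fun z => volume (Prod.mk z ⁻¹' (ψ '' (e ⁻¹' D))),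
    measurable_measure_prodMk_left himg, fun z => ?_, fun z => ?_, fun E hE => ?_⟩
  · have := hausdorffMeasure_le_of_dist_le (f := fun x => (e.symm x).2) (s := φ ⁻¹' {z} ∩ D)
      (K := 2) (d := ((m - n : ℕ) : ℝ)) (by positivity) (by
        intro x hx y hy
        rw [dist_eq_norm, dist_eq_norm]
        exact hkey x hx.2 y hy.2 (hx.1.trans hy.1.symm))
    beta_reduce
    rw [hslice]
    refine this.trans (le_of_eq ?_)
    rw [hvol, ENNReal.rpow_natCast]
    push_cast
    ring
  · have hlip : LipschitzWith 1 (fun x => (e.symm x).2) := by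
      refine LipschitzWith.of_dist_le_mul fun x y => ?_
      rw [dist_eq_norm, dist_eq_norm, ← Prod.snd_sub, ← map_sub]
      simpa using hge (e.symm (x - y))
    have := hlip.hausdorffMeasure_image_le (d := ((m - n : ℕ) : ℝ)) (by positivity)
      (φ ⁻¹' {z} ∩ D)
    rw [ENNReal.coe_one, ENNReal.one_rpow, one_mul, hvol, ← hslice] at this
    calc volume (Prod.mk z ⁻¹' (ψ '' (e ⁻¹' D)))
        = (c⁻¹ : ℝ≥0) * (c * volume (Prod.mk z ⁻¹' (ψ '' (e ⁻¹' D)))) := by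
          rw [← mul_assoc, ← ENNReal.coe_mul, inv_mul_cancel₀ hc0, ENNReal.coe_one, one_mul]
      _ ≤ _ := by gcongr
  · have h3 : ψ '' (e ⁻¹' (D ∩ φ ⁻¹' E)) = ψ '' (e ⁻¹' D) ∩ Prod.fst ⁻¹' E := by
      ext p
      constructor
      · rintro ⟨x, ⟨hx1, hx2⟩, rfl⟩
        exact ⟨⟨x, hx1, rfl⟩, hx2⟩
      · rintro ⟨⟨x, hx1, rfl⟩, hx2⟩
        exact ⟨x, ⟨hx1, hx2⟩, rfl⟩
    have h4 : ∫⁻ z in E, volume (Prod.mk z ⁻¹' (ψ '' (e ⁻¹' D))) =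
        volume (ψ '' (e ⁻¹' (D ∩ φ ⁻¹' E))) := by
      rw [h3, Measure.volume_eq_prod, Measure.prod_apply (himg.inter (measurable_fst hE)),
        ← lintegral_indicator hE]
      congr 1
      ext z
      by_cases hz : z ∈ E
      · rw [Set.indicator_of_mem hz]
        congr 1
        ext w
        simp [hz]
      · rw [Set.indicator_of_notMem hz]
        symm
        convert measure_empty (μ := (volume : Measure (EuclideanSpace ℝ (Fin (m - n)))))
        ext w
        simp [hz]
    have h5 : volume (e ⁻¹' (D ∩ φ ⁻¹' E)) = volume (D ∩ φ ⁻¹' E) :=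
      hmp.measure_preimage (hD.inter (hφ.measurable hE)).nullMeasurableSet
    have hsub : e ⁻¹' (D ∩ φ ⁻¹' E) ⊆ e ⁻¹' D := Set.preimage_mono Set.inter_subset_left
    rw [h4, ← h5]
    exact ⟨h2 _ _ (hψ.mono_set hsub), h1 _ _ (hψ.mono_set hsub)⟩

/-- The normal Jacobian `√(det(T ∘ T*))` of a linear map `T`. -/
noncomputable def linearNormalJacobian {m n : ℕ}
    (T : EuclideanSpace ℝ (Fin m) →L[ℝ] EuclideanSpace ℝ (Fin n)) : ℝ :=
  Real.sqrt (LinearMap.det ((T ∘L (ContinuousLinearMap.adjoint T)).toLinearMap))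

theorem continuous_linearNormalJacobian {m n : ℕ} :
    Continuous (linearNormalJacobian (m := m) (n := n)) := by
  refine Real.continuous_sqrt.comp (ContinuousLinearMap.continuous_det.comp ?_)
  exact continuous_id.clm_comp (ContinuousLinearMap.adjoint).continuous

theorem measurable_Jphi {m n : ℕ} (φ : EuclideanSpace ℝ (Fin m) → EuclideanSpace ℝ (Fin n)) :
    Measurable (Jphi m n φ) :=
  continuous_linearNormalJacobian.measurable.comp (measurable_fderiv ℝ φ)

theorem Jphi_nonneg {m n : ℕ} (φ : EuclideanSpace ℝ (Fin m) → EuclideanSpace ℝ (Fin n))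
    (x : EuclideanSpace ℝ (Fin m)) : 0 ≤ Jphi m n φ x :=
  Real.sqrt_nonneg _

theorem differentiableAt_of_Jphi_ne_zero {m n : ℕ} (hn : 1 ≤ n)
    {φ : EuclideanSpace ℝ (Fin m) → EuclideanSpace ℝ (Fin n)} {x : EuclideanSpace ℝ (Fin m)}
    (hx : Jphi m n φ x ≠ 0) : DifferentiableAt ℝ φ x := by
  by_contra h
  apply hx
  have : NeZero n := ⟨by omega⟩
  rw [Jphi, fderiv_zero_of_not_differentiableAt h]
  simp

theorem exists_partition_Jphi_comparable {m n : ℕ} (hn : 1 ≤ n)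
    (φ : EuclideanSpace ℝ (Fin m) → EuclideanSpace ℝ (Fin n))
    (δ : (EuclideanSpace ℝ (Fin m) →L[ℝ] EuclideanSpace ℝ (Fin n)) → ℝ≥0) (hδ : ∀ T, δ T ≠ 0) :
    ∃ (P : ℤ × ℕ → Set (EuclideanSpace ℝ (Fin m)))
      (T : ℤ × ℕ → EuclideanSpace ℝ (Fin m) →L[ℝ] EuclideanSpace ℝ (Fin n)),
      Pairwise (Function.onFun Disjoint P) ∧ (∀ i, MeasurableSet (P i)) ∧
      (⋃ i, P i) = {x | Jphi m n φ x ≠ 0} ∧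
      ∀ i, (P i).Nonempty → 0 < linearNormalJacobian (T i) ∧
        ApproximatesLinearOn φ (T i) (P i) (δ (T i)) ∧
        ∀ x ∈ P i, linearNormalJacobian (T i) / 2 ≤ Jphi m n φ x ∧
          Jphi m n φ x ≤ 2 * linearNormalJacobian (T i) := by
  let s : ℤ → Set (EuclideanSpace ℝ (Fin m)) :=
    fun j => {x | Jphi m n φ x ∈ Set.Ico ((2 : ℝ) ^ j) (2 ^ (j + 1))}
  have hspos : ∀ j, ∀ x ∈ s j, 0 < Jphi m n φ x := fun j x hx => lt_of_lt_of_le (by positivity) hx.1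
  have hsm : ∀ j, MeasurableSet (s j) := fun j => measurable_Jphi φ measurableSet_Ico
  have hsd : ∀ i j, i ≠ j → Disjoint (s i) (s j) := by
    intro i j hij
    rw [Set.disjoint_left]
    intro x hxi hxj
    apply hij
    have h1 := (zpow_lt_zpow_iff_right₀ (one_lt_two (α := ℝ))).1 (hxi.1.trans_lt hxj.2)
    have h2 := (zpow_lt_zpow_iff_right₀ (one_lt_two (α := ℝ))).1 (hxj.1.trans_lt hxi.2)
    omega
  have hpart := fun j => exists_partition_approximatesLinearOn_of_hasFDerivWithinAt φ (s j)
    (fderiv ℝ φ) (fun x hx => (differentiableAt_of_Jphi_ne_zero hn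
      (hspos j x hx).ne').hasFDerivAt.hasFDerivWithinAt) δ hδ
  choose t T htd htm hcov happ hT using hpart
  refine ⟨fun i => s i.1 ∩ t i.1 i.2, fun i => T i.1 i.2, ?_, fun i => (hsm _).inter (htm _ _),
    ?_, ?_⟩
  · rintro ⟨i, k⟩ ⟨j, l⟩ hne
    by_cases hij : i = j
    · subst hij
      have hkl : k ≠ l := fun h => hne (by rw [h])
      exact (htd i hkl).mono Set.inter_subset_right Set.inter_subset_right
    · exact (hsd i j hij).mono Set.inter_subset_left Set.inter_subset_left
  · ext x
    simp only [Set.mem_iUnion, Set.mem_ofPred_eq]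
    constructor
    · rintro ⟨i, hi⟩
      exact (hspos _ x hi.1).ne'
    · intro hx
      obtain ⟨j, hj⟩ := exists_mem_Ico_zpow (lt_of_le_of_ne (Jphi_nonneg φ x) hx.symm)
        (one_lt_two (α := ℝ))
      obtain ⟨k, hk⟩ := Set.mem_iUnion.1 (hcov j hj)
      exact ⟨(j, k), hj, hk⟩
  · rintro ⟨j, k⟩ ⟨x₁, hx₁⟩
    obtain ⟨y, hy, hyT⟩ := hT j ⟨x₁, hx₁.1⟩ k
    have hJy : linearNormalJacobian (T j k) = Jphi m n φ y := by rw [hyT]; rfl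
    dsimp only
    rw [hJy]
    refine ⟨hspos j y hy, happ j k, fun x hx => ?_⟩
    have h1 := hx.1
    have h2 : (2 : ℝ) ^ (j + 1) = 2 * 2 ^ j := by rw [zpow_add_one₀ two_ne_zero]; ring
    simp only [s, Set.mem_ofPred_eq, Set.mem_Ico, h2] at hy h1
    constructor <;> linarith [hy.1, hy.2, h1.1, h1.2]

/-- The mass of `φ⁻¹(z) ∩ A` with density `J_φ⁻¹` with respect to Hausdorff measure. -/
noncomputable def levelMass (m n : ℕ) (φ : EuclideanSpace ℝ (Fin m) → EuclideanSpace ℝ (Fin n))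
    (A : Set (EuclideanSpace ℝ (Fin m))) (z : EuclideanSpace ℝ (Fin n)) : ℝ≥0∞ :=
  ∫⁻ x in φ ⁻¹' {z} ∩ A, ENNReal.ofReal ((Jphi m n φ x)⁻¹) ∂(μH[(m : ℝ) - n])

theorem levelMass_le {m n : ℕ} {φ : EuclideanSpace ℝ (Fin m) → EuclideanSpace ℝ (Fin n)}
    (hφ : Continuous φ) {D : Set (EuclideanSpace ℝ (Fin m))} (hD : MeasurableSet D) {J : ℝ≥0}
    (hJ : 0 < J) (hDJ : ∀ x ∈ D, (J / 2 : ℝ) ≤ Jphi m n φ x) (z : EuclideanSpace ℝ (Fin n)) :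
    levelMass m n φ D z ≤ (2 * J⁻¹ : ℝ≥0) * μH[(m : ℝ) - n] (φ ⁻¹' {z} ∩ D) := by
  have hms : MeasurableSet (φ ⁻¹' {z} ∩ D) :=
    (hφ.measurable (measurableSet_singleton z)).inter hD
  rw [levelMass, ← setLIntegral_const]
  refine setLIntegral_mono' hms fun x hx => ?_
  rw [← ENNReal.ofReal_coe_nnreal]
  apply ENNReal.ofReal_le_ofReal
  have h1 := hDJ x hx.2
  have hJ' : (0 : ℝ) < J := hJ
  push_cast
  calc (Jphi m n φ x)⁻¹ ≤ (J / 2 : ℝ)⁻¹ := by gcongr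
    _ = 2 * (J : ℝ)⁻¹ := by field_simp

theorem hausdorffMeasure_le_levelMass {m n : ℕ}
    {φ : EuclideanSpace ℝ (Fin m) → EuclideanSpace ℝ (Fin n)}
    (hφ : Continuous φ) {D : Set (EuclideanSpace ℝ (Fin m))} (hD : MeasurableSet D) {J : ℝ≥0}
    (hJ : 0 < J)
    (hDJ : ∀ x ∈ D, 0 < Jphi m n φ x ∧ Jphi m n φ x ≤ 2 * J) (z : EuclideanSpace ℝ (Fin n)) :
    (J⁻¹ / 2 : ℝ≥0) * μH[(m : ℝ) - n] (φ ⁻¹' {z} ∩ D) ≤ levelMass m n φ D z := by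
  have hms : MeasurableSet (φ ⁻¹' {z} ∩ D) :=
    (hφ.measurable (measurableSet_singleton z)).inter hD
  rw [levelMass, ← setLIntegral_const]
  refine setLIntegral_mono' hms fun x hx => ?_
  rw [← ENNReal.ofReal_coe_nnreal]
  apply ENNReal.ofReal_le_ofReal
  obtain ⟨h0, h1⟩ := hDJ x hx.2
  have hJ' : (0 : ℝ) < J := hJ
  push_cast
  calc (J : ℝ)⁻¹ / 2 = (2 * J : ℝ)⁻¹ := by field_simp
    _ ≤ (Jphi m n φ x)⁻¹ := by gcongr

/-- Decomposition of the level mass along a countable measurable partition of `{J_φ ≠ 0}`. -/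
theorem levelMass_eq_tsum {m n : ℕ} {φ : EuclideanSpace ℝ (Fin m) → EuclideanSpace ℝ (Fin n)}
    (hφ : Continuous φ) {A : Set (EuclideanSpace ℝ (Fin m))} (hA : MeasurableSet A)
    {ι : Type*} [Countable ι] {P : ι → Set (EuclideanSpace ℝ (Fin m))}
    (hPd : Pairwise (Function.onFun Disjoint P)) (hPm : ∀ i, MeasurableSet (P i))
    (hPU : (⋃ i, P i) = {x | Jphi m n φ x ≠ 0}) (z : EuclideanSpace ℝ (Fin n)) :
    levelMass m n φ A z = ∑' i, levelMass m n φ (A ∩ P i) z := by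
  have hlev : MeasurableSet (φ ⁻¹' {z}) := hφ.measurable (measurableSet_singleton z)
  have hind : (fun x => ENNReal.ofReal ((Jphi m n φ x)⁻¹)) =
      (⋃ i, P i).indicator (fun x => ENNReal.ofReal ((Jphi m n φ x)⁻¹)) := by
    rw [hPU]
    symm
    rw [Set.indicator_eq_self]
    intro x hx h0
    apply hx
    simp [h0]
  unfold levelMass
  rw [hind, setLIntegral_indicator (MeasurableSet.iUnion hPm), ← hind, Set.inter_comm,
    Set.inter_iUnion, lintegral_iUnion]
  · simp only [Set.inter_assoc]
  · exact fun i => (hlev.inter hA).inter (hPm i)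
  · exact fun i j hij => (hPd hij).mono Set.inter_subset_right Set.inter_subset_right

/-- Coarea formula up to multiplicative constants. -/
theorem exists_comparable_coarea {m n : ℕ} (hn : 1 ≤ n) (hnm : n ≤ m)
    {φ : EuclideanSpace ℝ (Fin m) → EuclideanSpace ℝ (Fin n)} (hφ : Continuous φ)
    (hJ : ∀ᵐ x : EuclideanSpace ℝ (Fin m), Jphi m n φ x ≠ 0) :
    ∃ C : ℝ≥0, ∀ A : Set (EuclideanSpace ℝ (Fin m)), MeasurableSet A →
      ∃ G : EuclideanSpace ℝ (Fin n) → ℝ≥0∞, Measurable G ∧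
        (∀ z, levelMass m n φ A z ≤ C * G z) ∧ (∀ z, G z ≤ C * levelMass m n φ A z) ∧
        ∀ E, MeasurableSet E → volume (A ∩ φ ⁻¹' E) ≤ C * ∫⁻ z in E, G z ∧
          ∫⁻ z in E, G z ≤ C * volume (A ∩ φ ⁻¹' E) := by
  classical
  obtain ⟨c, hc0, hc⟩ := exists_hausdorffMeasure_eq_smul_volume (m - n)
  have hex : ∀ T : EuclideanSpace ℝ (Fin m) →L[ℝ] EuclideanSpace ℝ (Fin n),
      ∃ δ : ℝ≥0, 0 < δ ∧ (0 < linearNormalJacobian T →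
      ∀ D : Set (EuclideanSpace ℝ (Fin m)), MeasurableSet D → ApproximatesLinearOn φ T D δ →
      ∃ S : EuclideanSpace ℝ (Fin n) → ℝ≥0∞, Measurable S ∧
        (∀ z, μH[(m : ℝ) - n] (φ ⁻¹' {z} ∩ D) ≤ (2 ^ (m - n) * c : ℝ≥0) * S z) ∧
        (∀ z, S z ≤ (c⁻¹ : ℝ≥0) * μH[(m : ℝ) - n] (φ ⁻¹' {z} ∩ D)) ∧
        ∀ E, MeasurableSet E →
          ((linearNormalJacobian T).toNNReal / 2 : ℝ≥0) * volume (D ∩ φ ⁻¹' E) ≤ ∫⁻ z in E, S z ∧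
          ∫⁻ z in E, S z ≤
            (2 * (linearNormalJacobian T).toNNReal : ℝ≥0) * volume (D ∩ φ ⁻¹' E)) := by
    intro T
    by_cases hT : 0 < linearNormalJacobian T
    · obtain ⟨δ, hδ, h⟩ := exists_slice_measure_of_approximatesLinearOn hnm hc0 hc T
        (Real.sqrt_pos.1 hT).ne' (J := (linearNormalJacobian T).toNNReal)
        (Real.coe_toNNReal _ hT.le)
      exact ⟨δ, hδ, fun _ D hD happ => h φ D hφ hD happ⟩
    · exact ⟨1, one_pos, fun h => absurd h hT⟩
  choose δ hδ hS using hex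
  obtain ⟨P, T, hPd, hPm, hPU, hP⟩ := exists_partition_Jphi_comparable hn φ δ (fun T => (hδ T).ne')
  let C : ℝ≥0 := 2 * (2 ^ (m - n) * c) + 2 * c⁻¹ + 2
  have hC1 : 2 * (2 ^ (m - n) * c) ≤ C := by
    simp only [C]; rw [add_assoc]; exact le_self_add
  have hC2 : 2 * c⁻¹ ≤ C := by
    simp only [C]; rw [add_right_comm]; exact le_add_self
  have hC3 : 2 ≤ C := le_add_self
  refine ⟨C, fun A hA => ?_⟩
  have hpiece : ∀ i, ∃ G : EuclideanSpace ℝ (Fin n) → ℝ≥0∞, Measurable G ∧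
        (∀ z, levelMass m n φ (A ∩ P i) z ≤ C * G z) ∧
        (∀ z, G z ≤ C * levelMass m n φ (A ∩ P i) z) ∧
        ∀ E, MeasurableSet E → volume (A ∩ P i ∩ φ ⁻¹' E) ≤ C * ∫⁻ z in E, G z ∧
          ∫⁻ z in E, G z ≤ C * volume (A ∩ P i ∩ φ ⁻¹' E) := by
    intro i
    by_cases hne : (P i).Nonempty
    · obtain ⟨hpos, happ, hcomp⟩ := hP i hne
      have hD : MeasurableSet (A ∩ P i) := hA.inter (hPm i)
      obtain ⟨S, hSm, hS1, hS2, hS3⟩ := hS (T i) hpos (A ∩ P i) hD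
        (happ.mono_set Set.inter_subset_right)
      obtain ⟨J, hJeq⟩ : ∃ J : ℝ≥0, J = (linearNormalJacobian (T i)).toNNReal := ⟨_, rfl⟩
      have hJr : linearNormalJacobian (T i) = J := by rw [hJeq, Real.coe_toNNReal _ hpos.le]
      rw [← hJeq] at hS3
      rw [hJr] at hcomp hpos
      have hJ0 : 0 < J := hpos
      refine ⟨fun z => (J⁻¹ : ℝ≥0) * S z, hSm.const_mul _, fun z => ?_, fun z => ?_,
        fun E hE => ?_⟩
      · calc levelMass m n φ (A ∩ P i) z
            ≤ (2 * J⁻¹ : ℝ≥0) * μH[(m : ℝ) - n] (φ ⁻¹' {z} ∩ (A ∩ P i)) :=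
              levelMass_le hφ hD hJ0 (fun x hx => (hcomp x hx.2).1) z
          _ ≤ (2 * J⁻¹ : ℝ≥0) * ((2 ^ (m - n) * c : ℝ≥0) * S z) := by gcongr; exact hS1 z
          _ = (2 * (2 ^ (m - n) * c) : ℝ≥0) * ((J⁻¹ : ℝ≥0) * S z) := by push_cast; ring
          _ ≤ _ := by gcongr
      · have h1 := hausdorffMeasure_le_levelMass hφ hD hJ0 (fun x hx =>
          ⟨(half_pos hpos).trans_le (hcomp x hx.2).1, (hcomp x hx.2).2⟩) z
        calc (J⁻¹ : ℝ≥0) * S z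
            ≤ (J⁻¹ : ℝ≥0) * ((c⁻¹ : ℝ≥0) * μH[(m : ℝ) - n] (φ ⁻¹' {z} ∩ (A ∩ P i))) := by
              gcongr; exact hS2 z
          _ = (2 * c⁻¹ : ℝ≥0) * ((J⁻¹ / 2 : ℝ≥0) * μH[(m : ℝ) - n] (φ ⁻¹' {z} ∩ (A ∩ P i))) := by
              rw [← mul_assoc, ← mul_assoc, ← ENNReal.coe_mul, ← ENNReal.coe_mul]
              congr 2
              field_simp
          _ ≤ _ := by gcongr
      · obtain ⟨h1, h2⟩ := hS3 E hE
        rw [lintegral_const_mul _ hSm]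
        constructor
        · calc volume (A ∩ P i ∩ φ ⁻¹' E)
              = 2 * ((J⁻¹ : ℝ≥0) * ((J / 2 : ℝ≥0) * volume (A ∩ P i ∩ φ ⁻¹' E))) := by
                generalize volume (A ∩ P i ∩ φ ⁻¹' E) = v
                rw [← mul_assoc, ← mul_assoc, ← ENNReal.coe_ofNat, ← ENNReal.coe_mul,
                  ← ENNReal.coe_mul]
                have : 2 * J⁻¹ * (J / 2) = 1 := by field_simp
                rw [this, ENNReal.coe_one, one_mul]
            _ ≤ C * ((J⁻¹ : ℝ≥0) * ∫⁻ z in E, S z) := by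
                gcongr
                exact_mod_cast hC3
        · calc (J⁻¹ : ℝ≥0) * ∫⁻ z in E, S z
              ≤ (J⁻¹ : ℝ≥0) * ((2 * J : ℝ≥0) * volume (A ∩ P i ∩ φ ⁻¹' E)) := by gcongr
            _ = 2 * volume (A ∩ P i ∩ φ ⁻¹' E) := by
                rw [← mul_assoc, ← ENNReal.coe_mul]
                have : J⁻¹ * (2 * J) = 2 := by field_simp
                rw [this, ENNReal.coe_ofNat]
            _ ≤ _ := by
                gcongr
                exact_mod_cast hC3
    · rw [Set.not_nonempty_iff_eq_empty] at hne
      refine ⟨0, measurable_const, ?_, ?_, ?_⟩ <;> simp [hne, levelMass]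
  choose G hGm hG1 hG2 hG3 using hpiece
  have hvol : ∀ E, MeasurableSet E →
      volume (A ∩ φ ⁻¹' E) = ∑' i, volume (A ∩ P i ∩ φ ⁻¹' E) := by
    intro E hE
    rw [← measure_iUnion]
    · apply measure_congr
      have h1 : (⋃ i, A ∩ P i ∩ φ ⁻¹' E) = (A ∩ φ ⁻¹' E) ∩ {x | Jphi m n φ x ≠ 0} := by
        rw [← hPU, Set.inter_iUnion]
        exact Set.iUnion_congr fun i => Set.inter_right_comm _ _ _
      rw [h1]
      filter_upwards [hJ] with x hx
      apply propext
      exact ⟨fun h => ⟨h, hx⟩, fun h => h.1⟩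
    · exact fun i j hij => (hPd hij).mono (fun x hx => hx.1.2) (fun x hx => hx.1.2)
    · exact fun i => (hA.inter (hPm i)).inter (hφ.measurable hE)
  refine ⟨fun z => ∑' i, G i z, Measurable.tsum hGm, fun z => ?_, fun z => ?_,
    fun E hE => ?_⟩
  · rw [levelMass_eq_tsum hφ hA hPd hPm hPU, ← ENNReal.tsum_mul_left]
    exact ENNReal.tsum_le_tsum fun i => hG1 i z
  · rw [levelMass_eq_tsum hφ hA hPd hPm hPU, ← ENNReal.tsum_mul_left]
    exact ENNReal.tsum_le_tsum fun i => hG2 i z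
  · rw [hvol E hE, lintegral_tsum fun i => (hGm i).aemeasurable, ← ENNReal.tsum_mul_left,
      ← ENNReal.tsum_mul_left]
    exact ⟨ENNReal.tsum_le_tsum fun i => (hG3 i E hE).1,
      ENNReal.tsum_le_tsum fun i => (hG3 i E hE).2⟩

theorem lintegral_comp_comparable {X Y : Type*} [MeasurableSpace X] [MeasurableSpace Y]
    {μ : Measure X} {ν : Measure Y} {φ : X → Y} (hφ : Measurable φ) {A : Set X} {C : ℝ≥0}
    {G : Y → ℝ≥0∞} (hG : Measurable G)
    (h : ∀ E, MeasurableSet E → μ (A ∩ φ ⁻¹' E) ≤ C * ∫⁻ z in E, G z ∂ν ∧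
      ∫⁻ z in E, G z ∂ν ≤ C * μ (A ∩ φ ⁻¹' E))
    {g : Y → ℝ≥0∞} (hg : Measurable g) :
    ∫⁻ x in A, g (φ x) ∂μ ≤ C * ∫⁻ z, G z * g z ∂ν ∧
      ∫⁻ z, G z * g z ∂ν ≤ C * ∫⁻ x in A, g (φ x) ∂μ := by
  have hmap : ∀ E, MeasurableSet E → (μ.restrict A).map φ E = μ (A ∩ φ ⁻¹' E) := fun E hE => by
    rw [Measure.map_apply hφ hE, Measure.restrict_apply (hφ hE), Set.inter_comm]
  have h1 : (μ.restrict A).map φ ≤ (C : ℝ≥0∞) • ν.withDensity G := by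
    refine Measure.le_intro fun E hE _ => ?_
    rw [hmap E hE, Measure.smul_apply, withDensity_apply _ hE]
    exact (h E hE).1
  have h2 : ν.withDensity G ≤ (C : ℝ≥0∞) • (μ.restrict A).map φ := by
    refine Measure.le_intro fun E hE _ => ?_
    rw [Measure.smul_apply, hmap E hE, withDensity_apply _ hE]
    exact (h E hE).2
  have e1 : ∫⁻ x in A, g (φ x) ∂μ = ∫⁻ z, g z ∂((μ.restrict A).map φ) :=
    (lintegral_map hg hφ).symm
  have e2 : ∫⁻ z, G z * g z ∂ν = ∫⁻ z, g z ∂(ν.withDensity G) :=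
    (lintegral_withDensity_eq_lintegral_mul ν hG hg).symm
  rw [e1, e2]
  constructor
  · exact (lintegral_mono' h1 le_rfl).trans_eq (lintegral_smul_measure _ _)
  · exact (lintegral_mono' h2 le_rfl).trans_eq (lintegral_smul_measure _ _)

theorem exists_finset_ball_subset_iUnion_half {E : Type*} [NormedAddCommGroup E] [ProperSpace E]
    {r : ℝ} (hr : 0 < r) :
    ∃ s : Finset E, ∀ x : E, ball x r ⊆ ⋃ c : s, ball (x + (c : E)) (r / 2) := by
  obtain ⟨t, -, htf, ht⟩ := (isCompact_closedBall (0 : E) r).finite_cover_balls (half_pos hr)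
  refine ⟨htf.toFinset, fun x y hy => ?_⟩
  have h1 : y - x ∈ closedBall (0 : E) r := by
    rw [mem_closedBall_zero_iff, ← dist_eq_norm]
    exact (mem_ball.1 hy).le
  obtain ⟨c, hc, hyc⟩ := Set.mem_iUnion₂.1 (ht h1)
  refine Set.mem_iUnion.2 ⟨⟨c, htf.mem_toFinset.2 hc⟩, ?_⟩
  rw [mem_ball, dist_eq_norm] at hyc ⊢
  rwa [sub_add_eq_sub_sub]

theorem levelMass_ball_le_card_mul_iSup {m n : ℕ}
    {φ : EuclideanSpace ℝ (Fin m) → EuclideanSpace ℝ (Fin n)}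
    {r : ℝ} {s : Finset (EuclideanSpace ℝ (Fin m))} {A : Set (EuclideanSpace ℝ (Fin m))}
    {x : EuclideanSpace ℝ (Fin m)} (hs : ball x r ⊆ ⋃ c : s, ball (x + c) (r / 2))
    (hA : ∀ y ∈ ball x r, y ∉ A) (z : EuclideanSpace ℝ (Fin n)) :
    levelMass m n φ (ball x r) z ≤
      s.card * ⨆ y ∈ φ ⁻¹' {z} \ A, levelBallMass m n φ r z y := by
  have hsub : φ ⁻¹' {z} ∩ ball x r ⊆
      ⋃ c : s, φ ⁻¹' {z} ∩ (ball x r ∩ ball (x + c) (r / 2)) := by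
    intro y hy
    obtain ⟨c, hc⟩ := Set.mem_iUnion.1 (hs hy.2)
    exact Set.mem_iUnion.2 ⟨c, hy.1, hy.2, hc⟩
  have hpiece : ∀ c : s, levelMass m n φ (ball x r ∩ ball (x + c) (r / 2)) z ≤
      ⨆ y ∈ φ ⁻¹' {z} \ A, levelBallMass m n φ r z y := by
    intro c
    rcases (φ ⁻¹' {z} ∩ (ball x r ∩ ball (x + c) (r / 2))).eq_empty_or_nonempty with h | ⟨y, hy⟩
    · simp [levelMass, h]
    · refine le_trans ?_ (le_iSup₂ (f := fun y (_ : y ∈ φ ⁻¹' {z} \ A) =>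
        levelBallMass m n φ r z y) y ⟨hy.1, hA y hy.2.1⟩)
      refine lintegral_mono_set fun w hw => ⟨hw.1, ?_⟩
      have h1 := mem_ball.1 hw.2.2
      have h2 := mem_ball.1 hy.2.2
      rw [mem_ball]
      linarith [dist_triangle_right w y (x + c)]
  calc levelMass m n φ (ball x r) z
      ≤ ∑' c : s, levelMass m n φ (ball x r ∩ ball (x + c) (r / 2)) z :=
        (lintegral_mono_set hsub).trans (lintegral_iUnion_le _ _)
    _ ≤ ∑' _ : s, ⨆ y ∈ φ ⁻¹' {z} \ A, levelBallMass m n φ r z y :=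
        ENNReal.tsum_le_tsum hpiece
    _ = _ := by simp [tsum_fintype]

theorem nat_mul_iInf_levelBallMass_le_Psi {m n : ℕ}
    {φ : EuclideanSpace ℝ (Fin m) → EuclideanSpace ℝ (Fin n)} (hφ : Continuous φ)
    {r : ℝ} (hr : 0 < r) {A : Set (EuclideanSpace ℝ (Fin m))} {z : EuclideanSpace ℝ (Fin n)}
    (hconn : IsPreconnected (φ ⁻¹' {z})) {N : ℕ} {y y' : EuclideanSpace ℝ (Fin m)}
    (hy : φ y = z) (hy' : φ y' = z) (hdist : 2 * r * N ≤ dist y y')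
    (hA : ∀ a ∈ A, 2 * r * N < dist y a) :
    N * (⨅ w ∈ φ ⁻¹' {z} \ A, levelBallMass m n φ r z w) ≤ Psi m n φ z := by
  have hp : ∀ i : Fin N, ∃ p, φ p = z ∧ dist y p = 2 * r * (i : ℕ) := by
    intro i
    have hi : ((i : ℕ) : ℝ) ≤ N := by exact_mod_cast i.2.le
    have hmem : 2 * r * (i : ℕ) ∈ Set.Icc (dist y y) (dist y y') := by
      rw [dist_self]
      exact ⟨by positivity, (by gcongr : 2 * r * (i : ℕ) ≤ 2 * r * N).trans hdist⟩
    exact hconn.intermediate_value (f := fun w => dist y w) hy hy'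
      (by fun_prop) hmem
  choose p hpz hpd using hp
  have hpA : ∀ i, p i ∉ A := by
    intro i hi
    have h1 := hA _ hi
    rw [hpd] at h1
    have h2 : ((i : ℕ) : ℝ) ≤ N := by exact_mod_cast i.2.le
    exact absurd h1 (not_lt.2 (by gcongr))
  have hdisj : Pairwise (Function.onFun Disjoint fun i => φ ⁻¹' {z} ∩ ball (p i) r) := by
    intro i j hij
    refine (ball_disjoint_ball ?_).mono Set.inter_subset_right Set.inter_subset_right
    have h1 : |dist y (p i) - dist y (p j)| ≤ dist (p i) (p j) := by
      rw [dist_comm y, dist_comm y]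
      exact abs_dist_sub_le _ _ _
    have h2 : (1 : ℝ) ≤ |((i : ℕ) : ℝ) - ((j : ℕ) : ℝ)| := by
      have h3 : ((i : ℕ) : ℤ) - ((j : ℕ) : ℤ) ≠ 0 := by
        intro h; apply hij; ext; omega
      exact_mod_cast Int.one_le_abs h3
    rw [hpd, hpd, ← mul_sub, abs_mul, abs_of_pos (by positivity)] at h1
    nlinarith
  calc (N : ℝ≥0∞) * (⨅ w ∈ φ ⁻¹' {z} \ A, levelBallMass m n φ r z w)
      = ∑ _i : Fin N, ⨅ w ∈ φ ⁻¹' {z} \ A, levelBallMass m n φ r z w := by simp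
    _ ≤ ∑ i : Fin N, levelBallMass m n φ r z (p i) :=
        Finset.sum_le_sum fun i _ => iInf₂_le _ ⟨hpz i, hpA i⟩
    _ = ∫⁻ x in ⋃ i, φ ⁻¹' {z} ∩ ball (p i) r,
          ENNReal.ofReal ((Jphi m n φ x)⁻¹) ∂(μH[(m : ℝ) - n]) := by
        rw [lintegral_iUnion (fun i => (hφ.measurable (measurableSet_singleton z)).inter
          measurableSet_ball) hdisj, tsum_fintype]
        rfl
    _ ≤ Psi m n φ z :=
        lintegral_mono_set (Set.iUnion_subset fun i => Set.inter_subset_left)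

theorem LevelCoercive.exists_far {m n : ℕ}
    {φ : EuclideanSpace ℝ (Fin m) → EuclideanSpace ℝ (Fin n)} (hφ : LevelCoercive m n φ)
    {A : Set (EuclideanSpace ℝ (Fin m))} (hA : Bornology.IsBounded A)
    (x₀ : EuclideanSpace ℝ (Fin m)) (r : ℝ) {t : ℝ} (ht : 0 ≤ t) :
    ∃ R₀ : ℝ, ∀ x, R₀ ≤ dist x x₀ → ∀ y ∈ ball x r,
      (∃ y', φ y' = φ y ∧ t ≤ dist y y') ∧ ∀ a ∈ A, t < dist y a := by
  obtain ⟨ρ, hρ⟩ := ((hφ.2 (2 * t + 1) (by positivity)).union hA).subset_closedBall x₀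
  refine ⟨ρ + r + t, fun x hx y hy => ?_⟩
  have hy₀ : ρ + t < dist y x₀ := by
    have h1 := mem_ball.1 hy
    linarith [dist_triangle_left x x₀ y]
  constructor
  · by_contra! h
    have hmem : y ∈ closedBall x₀ ρ := by
      refine hρ (Or.inl (Metric.ediam_le fun a ha b hb => ?_))
      rw [edist_dist]
      apply ENNReal.ofReal_le_ofReal
      linarith [dist_triangle_left a b y, h a ha, h b hb]
    linarith [mem_closedBall.1 hmem]
  · intro a ha
    have h1 := mem_closedBall.1 (hρ (Or.inr ha))
    linarith [dist_triangle y a x₀]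

theorem ae_mul_levelMass_ball_le_Psi {m n : ℕ}
    {φ : EuclideanSpace ℝ (Fin m) → EuclideanSpace ℝ (Fin n)} (hφ : Continuous φ)
    (hcoer : LevelCoercive m n φ) (hconn : ∀ z, IsPreconnected (φ ⁻¹' {z}))
    {r : ℝ} (hr : 0 < r) {ε₀ : ℝ} {A : Set (EuclideanSpace ℝ (Fin m))}
    (hA : Bornology.IsBounded A)
    (hthick : ∀ᵐ z : EuclideanSpace ℝ (Fin n) ∂volume, z ∈ Set.range φ →
      ENNReal.ofReal ε₀ * (⨆ y ∈ φ ⁻¹' {z} \ A, levelBallMass m n φ r z y) ≤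
        ⨅ y ∈ φ ⁻¹' {z} \ A, levelBallMass m n φ r z y)
    (x₀ : EuclideanSpace ℝ (Fin m)) :
    ∃ K : ℕ, ∀ N : ℕ, ∃ R₀ : ℝ, ∀ x, R₀ ≤ dist x x₀ → ∀ᵐ z : EuclideanSpace ℝ (Fin n),
      ENNReal.ofReal ε₀ * N * levelMass m n φ (ball x r) z ≤ K * Psi m n φ z := by
  obtain ⟨s, hs⟩ := exists_finset_ball_subset_iUnion_half (E := EuclideanSpace ℝ (Fin m)) hr
  refine ⟨s.card, fun N => ?_⟩
  obtain ⟨R₀, hR₀⟩ := hcoer.exists_far hA x₀ r (t := 2 * r * N) (by positivity)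
  refine ⟨R₀, fun x hx => ?_⟩
  filter_upwards [hthick] with z hz
  rcases (φ ⁻¹' {z} ∩ ball x r).eq_empty_or_nonempty with h | ⟨y, hyz, hyx⟩
  · simp [levelMass, h]
  · obtain ⟨⟨y', hy', hyy'⟩, hyA⟩ := hR₀ x hx y hyx
    have hyz' : φ y = z := hyz
    have hdisj : ∀ w ∈ ball x r, w ∉ A := fun w hw hwA => by
      have h1 := (hR₀ x hx w hw).2 w hwA
      rw [dist_self] at h1
      exact absurd h1 (not_lt.2 (by positivity))
    calc ENNReal.ofReal ε₀ * N * levelMass m n φ (ball x r) z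
        ≤ ENNReal.ofReal ε₀ * N *
            (s.card * ⨆ y ∈ φ ⁻¹' {z} \ A, levelBallMass m n φ r z y) := by
          gcongr
          exact levelMass_ball_le_card_mul_iSup (hs x) hdisj z
      _ = s.card * (N * (ENNReal.ofReal ε₀ *
            ⨆ y ∈ φ ⁻¹' {z} \ A, levelBallMass m n φ r z y)) := by ring
      _ ≤ s.card * (N * ⨅ y ∈ φ ⁻¹' {z} \ A, levelBallMass m n φ r z y) := by
          gcongr
          exact hz ⟨y, hyz'⟩
      _ ≤ s.card * Psi m n φ z := by
          gcongr
          exact nat_mul_iInf_levelBallMass_le_Psi hφ hr (hconn z) hyz' (hy'.trans hyz') hyy' hyA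

/-- (Far-ball estimate, Euclidean case.) If `φ` is level-coercive, has
connected level sets and uniformly thick levels with thickness radius `r`, then the supremum
`σ_R` (over centers `x` with `‖x−x₀‖ ≥ R` and nonnegative measurable `h` with
`0 < ∫(h∘φ)^q < ∞`) of `∫_{B(x,r)}(h∘φ)^q / ∫_{ℝ^m}(h∘φ)^q` tends to `0` as `R → ∞`. -/
theorem stmt16 (m n : ℕ) (hn : 1 ≤ n) (hnm : n < m)
    (φ : EuclideanSpace ℝ (Fin m) → EuclideanSpace ℝ (Fin n))
    (hφ : ∃ L : ℝ≥0, LipschitzWith L φ)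
    (hJ : StandingJacobian m n φ)
    (hcoer : LevelCoercive m n φ)
    (hconn : ∀ z, IsConnected (φ ⁻¹' {z}) ∨ φ ⁻¹' {z} = ∅)
    (r : ℝ) (hr : 0 < r) (hthick : UniformlyThick m n φ r)
    (x₀ : EuclideanSpace ℝ (Fin m)) (q : ℝ) (hq : 1 ≤ q) :
    Tendsto (fun R : ℝ =>
      ⨆ (x : EuclideanSpace ℝ (Fin m)) (_ : R ≤ dist x x₀)
        (h : EuclideanSpace ℝ (Fin n) → ℝ) (_ : Measurable h) (_ : ∀ z, 0 ≤ h z)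
        (_ : 0 < ∫⁻ y, ENNReal.ofReal (h (φ y) ^ q) ∂volume)
        (_ : (∫⁻ y, ENNReal.ofReal (h (φ y) ^ q) ∂volume) < ⊤),
        (∫⁻ y in ball x r, ENNReal.ofReal (h (φ y) ^ q) ∂volume) /
          ∫⁻ y, ENNReal.ofReal (h (φ y) ^ q) ∂volume)
      atTop (nhds 0) := by
  obtain ⟨L, hL⟩ := hφ
  have hcont := hL.continuous
  have hpre : ∀ z, IsPreconnected (φ ⁻¹' {z}) := fun z =>
    (hconn z).elim (fun h => h.isPreconnected) (fun h => h ▸ isPreconnected_empty)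
  obtain ⟨ε₀, hε₀, A, -, hAb, hA⟩ := hthick
  obtain ⟨K, hK⟩ := ae_mul_levelMass_ball_le_Psi hcont hcoer hpre hr hAb hA x₀
  obtain ⟨C, hC⟩ := exists_comparable_coarea hn hnm.le hcont hJ.1
  obtain ⟨G, hGm, hG1, -, hG3⟩ := hC Set.univ MeasurableSet.univ
  have hPsi : ∀ z, Psi m n φ z = levelMass m n φ Set.univ z := fun z => by
    rw [Psi, levelMass, Set.inter_univ]
  rw [ENNReal.tendsto_nhds_zero]
  intro ε hε
  have hε' : ENNReal.ofReal ε₀ ≠ 0 := (ENNReal.ofReal_pos.2 hε₀).ne'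
  obtain ⟨N, hN⟩ := ENNReal.exists_nat_mul_gt (mul_ne_zero hε.ne' hε')
    (b := (C : ℝ≥0∞) ^ 4 * K) (by finiteness)
  have hN0 : N ≠ 0 := by rintro rfl; simp at hN
  obtain ⟨R₀, hR₀⟩ := hK N
  filter_upwards [eventually_ge_atTop R₀] with R hR
  refine iSup_le fun x => iSup_le fun hx => iSup_le fun h => iSup_le fun hh => iSup_le fun _ =>
    iSup_le fun _ => iSup_le fun _ => ENNReal.div_le_of_le_mul ?_
  obtain ⟨H, hHm, -, hH2, hH3⟩ := hC (ball x r) measurableSet_ball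
  have hg : Measurable fun z => ENNReal.ofReal (h z ^ q) := (hh.pow_const q).ennreal_ofReal
  have hball := (lintegral_comp_comparable hcont.measurable hHm hH3 hg).1
  have huniv := (lintegral_comp_comparable hcont.measurable hGm hG3 hg).2
  rw [Measure.restrict_univ] at huniv
  have hae : ∀ᵐ z : EuclideanSpace ℝ (Fin n),
      ENNReal.ofReal ε₀ * N * H z ≤ (C : ℝ≥0∞) ^ 2 * K * G z := by
    filter_upwards [hR₀ x (hR.trans hx)] with z hz
    calc ENNReal.ofReal ε₀ * N * H z
        ≤ ENNReal.ofReal ε₀ * N * (C * levelMass m n φ (ball x r) z) := by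
          gcongr
          exact hH2 z
      _ = C * (ENNReal.ofReal ε₀ * N * levelMass m n φ (ball x r) z) := by ring
      _ ≤ C * (K * (C * G z)) := by
          refine mul_le_mul' le_rfl (hz.trans ?_)
          rw [hPsi]
          exact mul_le_mul' le_rfl (hG1 z)
      _ = (C : ℝ≥0∞) ^ 2 * K * G z := by ring
  rw [← ENNReal.mul_le_mul_iff_right (a := ENNReal.ofReal ε₀ * N)
    (mul_ne_zero hε' (by exact_mod_cast hN0)) (by finiteness)]
  calc ENNReal.ofReal ε₀ * N * ∫⁻ y in ball x r, ENNReal.ofReal (h (φ y) ^ q)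
      ≤ ENNReal.ofReal ε₀ * N * (C * ∫⁻ z, H z * ENNReal.ofReal (h z ^ q)) := by gcongr
    _ = C * ∫⁻ z, ENNReal.ofReal ε₀ * N * (H z * ENNReal.ofReal (h z ^ q)) := by
        rw [lintegral_const_mul _ (show Measurable fun z => H z * _ from hHm.mul hg)]
        ring
    _ ≤ C * ∫⁻ z, (C : ℝ≥0∞) ^ 2 * K * (G z * ENNReal.ofReal (h z ^ q)) := by
        refine mul_le_mul' le_rfl (lintegral_mono_ae ?_)
        filter_upwards [hae] with z hz
        rw [← mul_assoc, ← mul_assoc]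
        exact mul_le_mul' hz le_rfl
    _ = (C : ℝ≥0∞) ^ 3 * K * ∫⁻ z, G z * ENNReal.ofReal (h z ^ q) := by
        rw [lintegral_const_mul _ (show Measurable fun z => G z * _ from hGm.mul hg)]
        ring
    _ ≤ (C : ℝ≥0∞) ^ 3 * K * (C * ∫⁻ y, ENNReal.ofReal (h (φ y) ^ q)) := by gcongr
    _ = (C : ℝ≥0∞) ^ 4 * K * ∫⁻ y, ENNReal.ofReal (h (φ y) ^ q) := by ring
    _ ≤ N * (ε * ENNReal.ofReal ε₀) * ∫⁻ y, ENNReal.ofReal (h (φ y) ^ q) := by gcongr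
    _ = _ := by ring
end
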